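/- arXiv:2206.07354 — 2 statements merged into one kernel-verified Lean document; each statement's English description precedes it below -/
import Mathlib

section
/- Let V be a finite set and ψ : V⁽²⁾ → ℤ/3ℤ an arbitrary map, and let H_ψ = (V,E) be the 3-uniform hypergraph in which a triple {x,y,z} of distinct vertices is an edge if and only if ψ(xy) + ψ(xz) + ψ(zy) ≡ 1 (mod 3). Then H_ψ contains no copy of K₅⁽³⁾: for every set U of five distinct vertices, at least one of the ten triples contained in U fails to be an edge of H_ψ. -/
/-- Example 3 (`ex:K5`): for any symmetric map `ψ : V⁽²⁾ → ℤ/3ℤ`, the hypergraph `H_ψ`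
whose edges are the triples `{x,y,z}` of distinct vertices with
`ψ(xy) + ψ(xz) + ψ(zy) ≡ 1 (mod 3)` contains no copy of `K₅⁽³⁾`: among any five distinct
vertices, some triple fails to be an edge. -/
theorem Hpsi_is_K5_free :
    ∀ (V : Type) (ψ : V → V → ZMod 3),
      (∀ x y : V, ψ x y = ψ y x) →
      ∀ f : Fin 5 → V, Function.Injective f →
        ∃ a b c : Fin 5, a ≠ b ∧ a ≠ c ∧ b ≠ c ∧
          ψ (f a) (f b) + ψ (f a) (f c) + ψ (f c) (f b) ≠ 1 := by
  intro V ψ hs f _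
  by_contra hcon
  have h : ∀ a b c : Fin 5, a ≠ b → a ≠ c → b ≠ c →
      ψ (f a) (f b) + ψ (f a) (f c) + ψ (f b) (f c) = 1 := by
    intro a b c hab hac hbc
    by_contra hne
    exact hcon ⟨a, b, c, hab, hac, hbc, by rwa [hs (f c) (f b)]⟩
  have h3 : (3 : ZMod 3) = 0 := by decide
  have h01 : (1 : ZMod 3) ≠ 0 := by decide
  have e012 := h 0 1 2 (by decide) (by decide) (by decide)
  have e013 := h 0 1 3 (by decide) (by decide) (by decide)
  have e014 := h 0 1 4 (by decide) (by decide) (by decide)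
  have e023 := h 0 2 3 (by decide) (by decide) (by decide)
  have e024 := h 0 2 4 (by decide) (by decide) (by decide)
  have e034 := h 0 3 4 (by decide) (by decide) (by decide)
  have e123 := h 1 2 3 (by decide) (by decide) (by decide)
  have e124 := h 1 2 4 (by decide) (by decide) (by decide)
  have e134 := h 1 3 4 (by decide) (by decide) (by decide)
  have e234 := h 2 3 4 (by decide) (by decide) (by decide)
  apply h01
  linear_combination (ψ (f 0) (f 1) + ψ (f 0) (f 2) + ψ (f 0) (f 3) + ψ (f 0) (f 4) + ψ (f 1) (f 2) + ψ (f 1) (f 3) + ψ (f 1) (f 4) + ψ (f 2) (f 3) + ψ (f 2) (f 4) + ψ (f 3) (f 4) - 3) * h3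
    - (e012 + e013 + e014 + e023 + e024 + e034 + e123 + e124 + e134 + e234)
end

section
/- For every ε > 0 there exist δ > 0 and n₀ ∈ ℕ such that every 3-uniform hypergraph H = (V,E) with |V| ≥ n₀ all of whose link graphs L_H(x), x ∈ V, are (δ, 1/3 + ε)-quasirandom contains a copy of K₅⁽³⁾. -/
open Finset

noncomputable section

/-- A `3`-uniform hypergraph with edge set `E` contains a copy of `K₅⁽³⁾`: five distinct
vertices all of whose ten triples are edges. -/
def ContainsK5 {V : Type} [DecidableEq V] (E : Finset (Finset V)) : Prop :=
  ∃ f : Fin 5 → V, Function.Injective f ∧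
    ∀ a b c : Fin 5, a ≠ b → a ≠ c → b ≠ c → ({f a, f b, f c} : Finset V) ∈ E

/-- The number of edges of the link graph `L_H(x)` lying inside `X`: the number of
`2`-element subsets `{y, z}` of `X` with `{x, y, z} ∈ E`. -/
def linkEdgesIn {V : Type} [DecidableEq V] (E : Finset (Finset V)) (x : V)
    (X : Finset V) : ℕ :=
  ((X.powersetCard 2).filter fun p => insert x p ∈ E).card

/-- A finite 3-graph bundled. -/
structure HG where
  V : Type
  fV : Fintype V
  dV : DecidableEq V
  E : Finset (Finset V)
  card3 : ∀ e ∈ E, e.card = 3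
  pos : 0 < Fintype.card V

attribute [instance] HG.fV HG.dV

/-- induced pattern -/
def pat {ι : Type} [Fintype ι] [DecidableEq ι] (H : HG) (x : ι → H.V) : Finset (Finset ι) :=
  univ.filter (fun e => e.card = 3 ∧ e.image x ∈ H.E)

/-- average of a function of the pattern -/
def av {ι : Type} [Fintype ι] [DecidableEq ι] (H : HG) (φ : Finset (Finset ι) → ℝ) : ℝ :=
  (∑ x : ι → H.V, φ (pat H x)) / (Fintype.card H.V : ℝ) ^ (Fintype.card ι)

structure Sys where
  H : ℕ → HG
  d : ℝ
  quasi : ∀ k x X, |(linkEdgesIn (H k).E x X : ℝ) - d * ((X.card : ℝ))^2 / 2| ≤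
            (1 / ((k : ℝ) + 1)) * ((Fintype.card (H k).V : ℝ))^2
  noK5 : ∀ k, ¬ ContainsK5 (H k).E

section avg
variable {ι : Type} [Fintype ι] [DecidableEq ι]

lemma cardpow_pos (H : HG) (m : ℕ) : (0 : ℝ) < (Fintype.card H.V : ℝ) ^ m := by
  have := H.pos
  positivity

lemma av_add (H : HG) (φ ψ : Finset (Finset ι) → ℝ) :
    av H (fun F => φ F + ψ F) = av H φ + av H ψ := by
  simp [av, Finset.sum_add_distrib, add_div]

lemma av_smul (H : HG) (c : ℝ) (φ : Finset (Finset ι) → ℝ) :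
    av H (fun F => c * φ F) = c * av H φ := by
  simp [av, ← Finset.mul_sum, mul_div_assoc]

lemma av_mono (H : HG) {φ ψ : Finset (Finset ι) → ℝ} (h : ∀ F, φ F ≤ ψ F) :
    av H φ ≤ av H ψ := by
  have := cardpow_pos H (Fintype.card ι)
  unfold av
  gcongr
  exact h _

lemma av_const (H : HG) (c : ℝ) : av H (fun _ : Finset (Finset ι) => c) = c := by
  have := cardpow_pos H (Fintype.card ι)
  unfold av
  simp
  field_simp

lemma av_abs (H : HG) (φ : Finset (Finset ι) → ℝ) :
    |av H φ| ≤ ∑ F, |φ F| := by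
  have h1 : ∀ F, |φ F| ≤ ∑ F, |φ F| := fun F =>
    Finset.single_le_sum (f := fun F => |φ F|) (fun _ _ => abs_nonneg _) (mem_univ F)
  rw [abs_le]
  constructor
  · rw [← av_const (ι := ι) H (-∑ F, |φ F|)]
    exact av_mono H (fun F => by linarith [neg_abs_le (φ F), h1 F])
  · rw [← av_const (ι := ι) H (∑ F, |φ F|)]
    exact av_mono H (fun F => by linarith [le_abs_self (φ F), h1 F])

/-- ultrafilter -/
def UU : Ultrafilter ℕ := Filter.hyperfilter ℕ

/-- limit functional -/
def Lf (S : Sys) (φ : Finset (Finset ι) → ℝ) : ℝ :=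
  Filter.limUnder (UU : Filter ℕ) (fun k => av (S.H k) φ)

lemma Lf_tendsto (S : Sys) (φ : Finset (Finset ι) → ℝ) :
    Filter.Tendsto (fun k => av (S.H k) φ) (UU : Filter ℕ) (nhds (Lf S φ)) := by
  apply tendsto_nhds_limUnder
  set M := ∑ F, |φ F|
  have hc : IsCompact (Set.Icc (-M) M) := isCompact_Icc
  obtain ⟨l, _, hl⟩ := hc.ultrafilter_le_nhds (UU.map (fun k => av (S.H k) φ)) (by
    rw [Filter.le_principal_iff]
    simp only [Ultrafilter.coe_map, Filter.mem_map]
    refine Filter.univ_mem' (fun k => ?_)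
    have := av_abs (S.H k) φ
    rw [abs_le] at this
    exact this)
  exact ⟨l, hl⟩

lemma Lf_eq (S : Sys) {φ : Finset (Finset ι) → ℝ} {l : ℝ}
    (h : Filter.Tendsto (fun k => av (S.H k) φ) (UU : Filter ℕ) (nhds l)) : Lf S φ = l :=
  tendsto_nhds_unique (Lf_tendsto S φ) h

lemma Lf_add (S : Sys) (φ ψ : Finset (Finset ι) → ℝ) :
    Lf S (fun F => φ F + ψ F) = Lf S φ + Lf S ψ := by
  apply Lf_eq
  simp_rw [av_add]
  exact (Lf_tendsto S φ).add (Lf_tendsto S ψ)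

lemma Lf_smul (S : Sys) (c : ℝ) (φ : Finset (Finset ι) → ℝ) :
    Lf S (fun F => c * φ F) = c * Lf S φ := by
  apply Lf_eq
  simp_rw [av_smul]
  exact (Lf_tendsto S φ).const_mul c

lemma Lf_const (S : Sys) (c : ℝ) : Lf S (fun _ : Finset (Finset ι) => c) = c := by
  apply Lf_eq
  simp_rw [av_const]
  exact tendsto_const_nhds

lemma Lf_mono (S : Sys) {φ ψ : Finset (Finset ι) → ℝ} (h : ∀ F, φ F ≤ ψ F) :
    Lf S φ ≤ Lf S ψ :=
  le_of_tendsto_of_tendsto' (Lf_tendsto S φ) (Lf_tendsto S ψ) (fun _ => av_mono _ h)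

lemma Lf_sum (S : Sys) {β : Type*} (s : Finset β) (φ : β → Finset (Finset ι) → ℝ) :
    Lf S (fun F => ∑ b ∈ s, φ b F) = ∑ b ∈ s, Lf S (φ b) := by
  classical
  induction s using Finset.induction_on with
  | empty => simp [Lf_const]
  | insert a s ha ih => simp_rw [Finset.sum_insert ha, Lf_add, ih]

/-- indicator -/
def ind (D F : Finset (Finset ι)) : ℝ := if D ⊆ F then 1 else 0

lemma ind_nonneg (D F : Finset (Finset ι)) : 0 ≤ ind D F := by unfold ind; split_ifs <;> norm_num
lemma ind_le_one (D F : Finset (Finset ι)) : ind D F ≤ 1 := by unfold ind; split_ifs <;> norm_num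

lemma ind_union (D D' F : Finset (Finset ι)) : ind (D ∪ D') F = ind D F * ind D' F := by
  unfold ind
  by_cases h : D ⊆ F <;> by_cases h' : D' ⊆ F <;> simp [Finset.union_subset_iff, h, h']

/-- limiting density -/
def TT (S : Sys) (D : Finset (Finset ι)) : ℝ := Lf S (ind D)

lemma TT_nonneg (S : Sys) (D : Finset (Finset ι)) : 0 ≤ TT S D := by
  rw [← Lf_const (ι := ι) S 0]; exact Lf_mono S (ind_nonneg D)

lemma TT_le_one (S : Sys) (D : Finset (Finset ι)) : TT S D ≤ 1 := by
  rw [← Lf_const (ι := ι) S 1]; exact Lf_mono S (ind_le_one D)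

lemma TT_anti (S : Sys) {D D' : Finset (Finset ι)} (h : D ⊆ D') : TT S D' ≤ TT S D := by
  apply Lf_mono
  intro F
  unfold ind
  by_cases h' : D' ⊆ F
  · simp [h', h.trans h']
  · simp only [h', if_false]; split_ifs <;> norm_num

lemma TT_empty (S : Sys) : TT S (∅ : Finset (Finset ι)) = 1 := by
  have : (ind (∅ : Finset (Finset ι))) = fun _ => 1 := by ext F; simp [ind]
  unfold TT; rw [this, Lf_const]

/-- if `φ ≤ 0` on all patterns of positive density then the limit is `≤ 0`. -/
lemma Lf_nonpos (S : Sys) (φ : Finset (Finset ι) → ℝ) (h : ∀ F, 0 < TT S F → φ F ≤ 0) :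
    Lf S φ ≤ 0 := by
  have h1 : Lf S φ ≤ Lf S (fun F => ∑ G, max (φ G) 0 * ind G F) := by
    apply Lf_mono
    intro F
    calc φ F ≤ max (φ F) 0 * ind F F := by simp [ind]
      _ ≤ _ := Finset.single_le_sum (f := fun G => max (φ G) 0 * ind G F)
        (fun G _ => mul_nonneg (le_max_right _ _) (ind_nonneg _ _)) (mem_univ F)
  refine h1.trans ?_
  rw [Lf_sum]
  apply Finset.sum_nonpos
  intro G _
  rw [Lf_smul]
  rcases (TT_nonneg S G).eq_or_lt with h0 | h0
  · unfold TT at h0; rw [← h0]; simp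
  · rw [max_eq_right (h G h0)]; simp

lemma exists_pat (S : Sys) (D : Finset (Finset ι)) (hD : 0 < TT S D) (φ : Finset (Finset ι) → ℝ)
    (h : 0 ≤ Lf S (fun F => φ F * ind D F)) : ∃ F, 0 < TT S F ∧ D ⊆ F ∧ 0 ≤ φ F := by
  by_contra hcon
  push Not at hcon
  obtain ⟨γ, hγ, hγ'⟩ : ∃ γ : ℝ, 0 < γ ∧ ∀ F, φ F < 0 → φ F ≤ -γ := by
    let s := (univ : Finset (Finset (Finset ι))).filter (fun F => φ F < 0)
    by_cases hs : s.Nonempty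
    · obtain ⟨G, hG, hm⟩ := s.exists_max_image φ hs
      refine ⟨-φ G, by simpa [s] using hG, fun F hF => ?_⟩
      have := hm F (by simpa [s] using hF)
      linarith
    · refine ⟨1, one_pos, fun F hF => ?_⟩
      exact absurd ⟨F, by simpa [s] using hF⟩ hs
  have := Lf_nonpos S (fun F => φ F * ind D F + γ * ind D F) (by
    intro F hF
    by_cases hDF : D ⊆ F
    · have := hγ' F (hcon F hF hDF)
      simp [ind, hDF]; linarith
    · simp [ind, hDF])
  rw [Lf_add, Lf_smul] at this
  have h2 : 0 < γ * Lf S (ind D) := mul_pos hγ hD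
  linarith

end avg

section cut
variable {V : Type} [Fintype V] [DecidableEq V]

/-- link indicator -/
def lk (E : Finset (Finset V)) (x y z : V) : ℝ := if ({x, y, z} : Finset V) ∈ E then 1 else 0

lemma lk_symm (E : Finset (Finset V)) (x y z : V) : lk E x y z = lk E x z y := by
  unfold lk
  rw [show ({x, y, z} : Finset V) = {x, z, y} by ext; simp; tauto]

lemma lk_diag (E : Finset (Finset V)) (hE : ∀ e ∈ E, e.card = 3) (x y : V) : lk E x y y = 0 := by
  unfold lk
  rw [if_neg]
  intro h
  have := hE _ h
  have h2 : ({x, y, y} : Finset V).card ≤ 2 := by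
    simpa using Finset.card_le_two (a := x) (b := y)
  omega

/-- bilinear count -/
def lks (E : Finset (Finset V)) (x : V) (A B : Finset V) : ℝ := ∑ y ∈ A, ∑ z ∈ B, lk E x y z

lemma lks_self (E : Finset (Finset V)) (hE : ∀ e ∈ E, e.card = 3) (x : V) (X : Finset V) :
    lks E x X X = 2 * linkEdgesIn E x X := by
  unfold lks lk
  rw [← Finset.sum_product', Finset.sum_boole]
  unfold linkEdgesIn
  norm_cast
  rw [Finset.card_eq_sum_card_fiberwise (f := fun q : V × V => ({q.1, q.2} : Finset V))
    (t := (X.powersetCard 2).filter fun p => insert x p ∈ E)]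
  · rw [Finset.sum_const_nat (m := 2), mul_comm]
    intro p hp
    simp only [Finset.mem_filter, Finset.mem_powersetCard] at hp
    obtain ⟨⟨h1, h2⟩, h3⟩ := hp
    obtain ⟨u, v, huv, rfl⟩ := Finset.card_eq_two.1 h2
    have hu : u ∈ X := h1 (by simp)
    have hv : v ∈ X := h1 (by simp)
    rw [show (filter (fun q : V × V => ({q.1, q.2} : Finset V) = {u, v})
      (filter (fun i : V × V => ({x, i.1, i.2} : Finset V) ∈ E) (X ×ˢ X))) = {(u, v), (v, u)} from ?_]
    · rw [Finset.card_pair]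
      simp [huv]
    · ext ⟨a, b⟩
      simp only [Finset.mem_filter, Finset.mem_product, Finset.mem_insert, Finset.mem_singleton,
        Prod.mk.injEq]
      constructor
      · rintro ⟨⟨⟨_, _⟩, _⟩, h⟩
        have ha : a ∈ ({u, v} : Finset V) := by rw [← h]; simp
        have hb : b ∈ ({u, v} : Finset V) := by rw [← h]; simp
        have hu' : u ∈ ({a, b} : Finset V) := by rw [h]; simp
        have hv' : v ∈ ({a, b} : Finset V) := by rw [h]; simp
        simp only [Finset.mem_insert, Finset.mem_singleton] at ha hb hu' hv'
        grind
      · rintro (⟨rfl, rfl⟩ | ⟨rfl, rfl⟩)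
        · exact ⟨⟨⟨hu, hv⟩, h3⟩, rfl⟩
        · refine ⟨⟨⟨hv, hu⟩, ?_⟩, Finset.pair_comm _ _⟩
          rw [Finset.pair_comm]; exact h3
  · rintro ⟨a, b⟩ h
    simp only [Finset.coe_filter, Finset.mem_product, Set.mem_ofPred_eq, Finset.mem_powersetCard] at h ⊢
    obtain ⟨⟨ha, hb⟩, h3⟩ := h
    refine ⟨⟨?_, ?_⟩, h3⟩
    · intro t; simp; rintro (rfl | rfl) <;> assumption
    · apply Finset.card_pair
      rintro rfl
      have := hE _ h3
      have h2 : ({x, a, a} : Finset V).card ≤ 2 := by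
        simpa using Finset.card_le_two (a := x) (b := a)
      omega

lemma lks_comm (E : Finset (Finset V)) (x : V) (A B : Finset V) : lks E x A B = lks E x B A := by
  unfold lks
  rw [Finset.sum_comm]
  simp_rw [lk_symm E x]

lemma lks_union_left (E : Finset (Finset V)) (x : V) {A A' : Finset V} (B : Finset V)
    (h : Disjoint A A') : lks E x (A ∪ A') B = lks E x A B + lks E x A' B := by
  unfold lks; rw [Finset.sum_union h]

lemma lks_union_right (E : Finset (Finset V)) (x : V) (A : Finset V) {B B' : Finset V}
    (h : Disjoint B B') : lks E x A (B ∪ B') = lks E x A B + lks E x A B' := by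
  rw [lks_comm, lks_union_left _ _ _ h, lks_comm, lks_comm E x B']

lemma lks_disj (E : Finset (Finset V)) (hE : ∀ e ∈ E, e.card = 3) (x : V) (d M : ℝ)
    (hq : ∀ X : Finset V, |(linkEdgesIn E x X : ℝ) - d * ((X.card : ℝ))^2 / 2| ≤ M)
    (A B : Finset V) (h : Disjoint A B) : |lks E x A B - d * (A.card * B.card)| ≤ 3 * M := by
  have h1 := lks_self E hE x (A ∪ B)
  rw [lks_union_left _ _ _ h, lks_union_right _ _ _ h, lks_union_right _ _ _ h,
    lks_comm E x B A, lks_self E hE, lks_self E hE] at h1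
  have h2 := hq (A ∪ B)
  rw [Finset.card_union_of_disjoint h] at h2
  push_cast at h2
  have h3 := hq A
  have h4 := hq B
  rw [abs_le] at *
  constructor <;> nlinarith

lemma lks_cut (E : Finset (Finset V)) (hE : ∀ e ∈ E, e.card = 3) (x : V) (d M : ℝ)
    (hq : ∀ X : Finset V, |(linkEdgesIn E x X : ℝ) - d * ((X.card : ℝ))^2 / 2| ≤ M)
    (A B : Finset V) : |lks E x A B - d * (A.card * B.card)| ≤ 11 * M := by
  have hA : A = (A \ B) ∪ (A ∩ B) := (Finset.sdiff_union_inter A B).symm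
  have hB : B = (B \ A) ∪ (A ∩ B) := by rw [Finset.inter_comm]; exact (Finset.sdiff_union_inter B A).symm
  have dA : Disjoint (A \ B) (A ∩ B) := Finset.disjoint_sdiff_inter A B
  have dB : Disjoint (B \ A) (A ∩ B) := by rw [Finset.inter_comm]; exact Finset.disjoint_sdiff_inter B A
  have dAB : Disjoint (A \ B) (B \ A) := disjoint_sdiff_sdiff
  have cA : (A.card : ℝ) = (A \ B).card + (A ∩ B).card := by
    rw [← Nat.cast_add, ← Finset.card_union_of_disjoint dA, ← hA]
  have cB : (B.card : ℝ) = (B \ A).card + (A ∩ B).card := by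
    rw [← Nat.cast_add, ← Finset.card_union_of_disjoint dB, ← hB]
  have e0 : lks E x A B = lks E x (A \ B) (B \ A) + lks E x (A \ B) (A ∩ B) +
      lks E x (B \ A) (A ∩ B) + lks E x (A ∩ B) (A ∩ B) := by
    have hr : ∀ A1, lks E x A1 B = lks E x A1 (B \ A) + lks E x A1 (A ∩ B) := by
      intro A1
      rw [← lks_union_right _ _ _ dB, ← hB]
    have hl : lks E x A B = lks E x (A \ B) B + lks E x (A ∩ B) B := by
      rw [← lks_union_left _ _ _ dA, ← hA]
    rw [hl, hr, hr, lks_comm E x (A ∩ B) (B \ A)]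
    ring
  have h1 := lks_disj E hE x d M hq _ _ dAB
  have h2 := lks_disj E hE x d M hq _ _ dA
  have h3 := lks_disj E hE x d M hq _ _ dB
  have h4 := hq (A ∩ B)
  have h5 := lks_self E hE x (A ∩ B)
  rw [e0, cA, cB]
  rw [abs_le] at *
  constructor <;> nlinarith

end cut

section averaging
variable {ι : Type} [Fintype ι] [DecidableEq ι] {V : Type} [Fintype V] [DecidableEq V]

lemma sum_update (c : ι) (g : (ι → V) → ℝ) :
    ∑ x : ι → V, ∑ y : V, g (Function.update x c y) = (Fintype.card V : ℝ) * ∑ x, g x := by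
  have hinv : Function.Involutive (fun q : (ι → V) × V => (Function.update q.1 c q.2, q.1 c)) := by
    rintro ⟨x, y⟩; simp
  rw [← Fintype.sum_prod_type' (fun x y => g (Function.update x c y))]
  rw [Fintype.sum_equiv (hinv.toPerm) _ (fun q : (ι → V) × V => g q.1) (by intro q; rfl)]
  rw [Fintype.sum_prod_type]
  simp [Finset.mul_sum]

end averaging

section link
variable {ι : Type} [Fintype ι] [DecidableEq ι]

lemma subset_pat (H : HG) (D : Finset (Finset ι)) (x : ι → H.V) :
    D ⊆ pat H x ↔ ∀ e ∈ D, e.card = 3 ∧ e.image x ∈ H.E := by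
  simp [Finset.subset_iff, pat]

lemma link_host (H : HG) (d M : ℝ)
    (hq : ∀ x X, |(linkEdgesIn H.E x X : ℝ) - d * ((X.card : ℝ))^2 / 2| ≤ M)
    (D : Finset (Finset ι)) (a c c' : ι) (hac : a ≠ c) (hac' : a ≠ c') (hcc : c ≠ c')
    (hD : ∀ e ∈ D, ¬ (c ∈ e ∧ c' ∈ e)) :
    |av H (ind (insert {a, c, c'} D)) - d * av H (ind D)| * (Fintype.card H.V : ℝ) ^ 2 ≤ 11 * M := by
  classical
  set n : ℝ := (Fintype.card H.V : ℝ) with hn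
  have hnpos : 0 < n := by have := H.pos; positivity
  set g : (ι → H.V) → ℝ := fun x => ind (insert {a, c, c'} D) (pat H x) - d * ind D (pat H x) with hg
  have e1 : av H (ind (insert {a, c, c'} D)) - d * av H (ind D) = (∑ x, g x) / n ^ (Fintype.card ι) := by
    unfold av
    rw [hg, Finset.sum_sub_distrib, ← Finset.mul_sum]
    ring
  have e2 : ∑ x : ι → H.V, ∑ y, ∑ z, g (Function.update (Function.update x c y) c' z) = n ^ 2 * ∑ x, g x := by
    have h1 := sum_update (V := H.V) c (fun x => ∑ z, g (Function.update x c' z))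
    rw [h1, sum_update, ← mul_assoc, sq]
  have e3 : ∀ x : ι → H.V, |∑ y, ∑ z, g (Function.update (Function.update x c y) c' z)| ≤ 11 * M := by
    intro x
    set A : Finset H.V := univ.filter (fun y => ∀ e ∈ D, c' ∉ e → e.card = 3 ∧ e.image (Function.update x c y) ∈ H.E) with hA
    set B : Finset H.V := univ.filter (fun z => ∀ e ∈ D, c' ∈ e → e.card = 3 ∧ e.image (Function.update x c' z) ∈ H.E) with hB
    have key : ∀ y z, (D ⊆ pat H (Function.update (Function.update x c y) c' z)) ↔ (y ∈ A ∧ z ∈ B) := by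
      intro y z
      rw [subset_pat]
      simp only [hA, hB, Finset.mem_filter, Finset.mem_univ, true_and]
      rw [← forall₂_and]
      refine forall₂_congr (fun e he => ?_)
      by_cases hc' : c' ∈ e
      · have hc : c ∉ e := fun h => hD e he ⟨h, hc'⟩
        have : e.image (Function.update (Function.update x c y) c' z) = e.image (Function.update x c' z) := by
          apply Finset.image_congr
          intro i hi
          by_cases h : i = c'
          · subst h; simp
          · have : i ≠ c := by rintro rfl; exact hc hi
            simp [h, this]
        rw [this]; simp [hc']
      · have : e.image (Function.update (Function.update x c y) c' z) = e.image (Function.update x c y) := by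
          apply Finset.image_congr
          intro i hi
          have h : i ≠ c' := by rintro rfl; exact hc' hi
          simp [h]
        rw [this]; simp [hc']
    have k1 : ∀ y z, ind D (pat H (Function.update (Function.update x c y) c' z)) = (if y ∈ A then 1 else 0) * (if z ∈ B then 1 else 0) := by
      intro y z
      unfold ind
      simp only [key]
      by_cases h : y ∈ A <;> by_cases h' : z ∈ B <;> simp [h, h']
    have k2 : ∀ y z, ind (insert {a, c, c'} D) (pat H (Function.update (Function.update x c y) c' z)) = (if y ∈ A then 1 else 0) * (if z ∈ B then 1 else 0) * lk H.E (x a) y z := by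
      intro y z
      rw [← k1, Finset.insert_eq, ind_union, mul_comm]
      congr 1
      unfold ind lk
      simp only [subset_pat]
      simp [hac, hac', hcc, Finset.image_insert, Finset.card_insert_of_notMem]
    have k3 : ∑ y, ∑ z, g (Function.update (Function.update x c y) c' z) = lks H.E (x a) A B - d * (A.card * B.card) := by
      simp only [hg, k1, k2, Finset.sum_sub_distrib]
      congr 1
      · unfold lks
        rw [← Finset.sum_filter_add_sum_filter_not univ (· ∈ A)]
        rw [Finset.sum_eq_zero (s := filter (· ∉ A) univ)]
        · simp only [add_zero, Finset.filter_univ_mem]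
          refine Finset.sum_congr rfl (fun y hy => ?_)
          simp [hy, Finset.sum_ite_mem]
        · intro y hy
          simp at hy
          simp [hy]
      · simp_rw [← Finset.mul_sum, ← Finset.sum_mul]
        simp
    rw [k3]
    exact lks_cut H.E H.card3 (x a) d M (hq (x a)) A B
  rw [e1, abs_div, abs_of_pos (show 0 < n ^ (Fintype.card ι) by positivity), div_mul_eq_mul_div,
    div_le_iff₀ (by positivity)]
  calc |∑ x, g x| * n ^ 2 = |n ^ 2 * ∑ x, g x| := by rw [abs_mul, abs_of_pos (show 0 < n ^ 2 by positivity)]; ring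
    _ ≤ ∑ x : ι → H.V, 11 * M := by
      rw [← e2]
      exact (Finset.abs_sum_le_sum_abs _ _).trans (Finset.sum_le_sum (fun x _ => e3 x))
    _ = _ := by simp [hn]; ring

lemma TT_link (S : Sys) (D : Finset (Finset ι)) (a c c' : ι) (hac : a ≠ c) (hac' : a ≠ c')
    (hcc : c ≠ c') (hD : ∀ e ∈ D, ¬ (c ∈ e ∧ c' ∈ e)) :
    TT S (insert {a, c, c'} D) = S.d * TT S D := by
  have h0 : Filter.Tendsto (fun k : ℕ => 11 * (1 / ((k : ℝ) + 1))) (UU : Filter ℕ) (nhds 0) := by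
    have := (tendsto_one_div_add_atTop_nhds_zero_nat (𝕜 := ℝ)).const_mul 11
    rw [mul_zero] at this
    refine this.mono_left ?_
    unfold UU
    exact Nat.hyperfilter_le_atTop
  have h1 : Filter.Tendsto (fun k => av (S.H k) (ind (insert {a, c, c'} D)) - S.d * av (S.H k) (ind D)) (UU : Filter ℕ) (nhds 0) := by
    refine squeeze_zero_norm (fun k => ?_) h0
    have := link_host (S.H k) S.d _ (S.quasi k) D a c c' hac hac' hcc hD
    rw [Real.norm_eq_abs]
    have hp := cardpow_pos (S.H k) 2
    rw [← mul_assoc] at this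
    exact le_of_mul_le_mul_right this hp
  have h2 := (Lf_tendsto S (ind (insert {a, c, c'} D))).sub ((Lf_tendsto S (ind D)).const_mul S.d)
  have := tendsto_nhds_unique h1 h2
  unfold TT
  linarith

end link

section ext
variable {ι : Type} [Fintype ι] [DecidableEq ι]

lemma ext_step (S : Sys) (D : Finset (Finset ι)) (hD : 0 < TT S D) (P : Finset ι) (hP : P.card = 2)
    (hc : ∀ e ∈ D, ¬ P ⊆ e) (w : ι → ℝ) (hw : ∀ z ∈ P, w z = 0) :
    ∃ W : Finset ι, (∀ z ∈ W, w z ≠ 0) ∧ S.d * ∑ z, w z ≤ ∑ z ∈ W, w z ∧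
      0 < TT S (D ∪ W.image (fun z => insert z P)) := by
  obtain ⟨c, c', hcc, rfl⟩ := Finset.card_eq_two.1 hP
  obtain ⟨F, hF, hDF, hφ⟩ := exists_pat S D hD
    (fun F => ∑ z, w z * ind {insert z {c, c'}} F + (-(S.d * ∑ z, w z))) (by
      have : (fun F => (∑ z, w z * ind {insert z {c, c'}} F + (-(S.d * ∑ z, w z))) * ind D F) =
          fun F => ∑ z, w z * ind (insert (insert z {c, c'}) D) F + (-(S.d * ∑ z, w z)) * ind D F := by
        ext F
        rw [add_mul, Finset.sum_mul]
        congr 1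
        refine Finset.sum_congr rfl (fun z _ => ?_)
        rw [Finset.insert_eq (a := insert z {c, c'}) (s := D), ind_union]
        ring
      rw [this, Lf_add, Lf_sum, Lf_smul]
      simp_rw [Lf_smul]
      have h2 : ∀ z, w z * Lf S (ind (insert (insert z {c, c'}) D)) = w z * (S.d * TT S D) := by
        intro z
        by_cases hz : z ∈ ({c, c'} : Finset ι)
        · rw [hw z hz]; simp
        · simp at hz
          have := TT_link S D z c c' (by tauto) (by tauto) hcc (by
            rintro e he ⟨h1, h2⟩
            apply hc e he
            intro t; simp; rintro (rfl | rfl) <;> assumption)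
          unfold TT at this
          rw [this]; rfl
      simp_rw [h2, ← Finset.sum_mul]
      unfold TT
      apply le_of_eq
      ring)
  refine ⟨univ.filter (fun z => w z ≠ 0 ∧ insert z {c, c'} ∈ F), by simp; tauto, ?_, ?_⟩
  · have : ∑ z, w z * ind {insert z {c, c'}} F =
        ∑ z ∈ univ.filter (fun z => w z ≠ 0 ∧ insert z {c, c'} ∈ F), w z := by
      rw [Finset.sum_filter]
      refine Finset.sum_congr rfl (fun z _ => ?_)
      by_cases h : w z = 0
      · simp [h]
      · simp [h, ind]
    rw [← this]; linarith
  · refine lt_of_lt_of_le hF (TT_anti S ?_)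
    refine Finset.union_subset hDF ?_
    intro e he
    simp only [Finset.mem_image, Finset.mem_filter] at he
    obtain ⟨z, ⟨_, _, h⟩, rfl⟩ := he
    exact h

lemma TT_pos_exists (S : Sys) (D : Finset (Finset ι)) (hD : 0 < TT S D) :
    ∃ k, ∃ x : ι → (S.H k).V, D ⊆ pat (S.H k) x := by
  by_contra hcon
  push Not at hcon
  have : TT S D = 0 := by
    apply Lf_eq
    have : (fun k => av (S.H k) (ind D)) = fun _ => 0 := by
      ext k
      unfold av
      rw [Finset.sum_eq_zero]
      · simp
      · intro x _
        simp [ind, hcon k x]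
    rw [this]; exact tendsto_const_nhds
  linarith

lemma TT_K5 (S : Sys) (D : Finset (Finset ι)) (g : Fin 5 → ι)
    (h : ∀ a b c : Fin 5, a ≠ b → a ≠ c → b ≠ c → ({g a, g b, g c} : Finset ι) ∈ D) :
    ¬ 0 < TT S D := by
  intro hD
  obtain ⟨k, x, hx⟩ := TT_pos_exists S D hD
  rw [subset_pat] at hx
  have hE : ∀ a b c : Fin 5, a ≠ b → a ≠ c → b ≠ c →
      ({x (g a), x (g b), x (g c)} : Finset (S.H k).V) ∈ (S.H k).E := by
    intro a b c h1 h2 h3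
    simpa [Finset.image_insert] using (hx _ (h a b c h1 h2 h3)).2
  refine S.noK5 k ⟨fun i => x (g i), ?_, hE⟩
  intro a b hab
  by_contra hne
  obtain ⟨c, hc1, hc2⟩ : ∃ c : Fin 5, a ≠ c ∧ b ≠ c := by
    clear hab hne; revert a b; decide
  have h1 := (S.H k).card3 _ (hE a b c hne hc1 hc2)
  simp only at hab
  rw [hab] at h1
  have h2 : ({x (g b), x (g b), x (g c)} : Finset (S.H k).V).card ≤ 2 := by
    simpa using Finset.card_le_two (a := x (g b)) (b := x (g c))
  omega

lemma TT_star (S : Sys) (c : ι) (D : Finset (Finset ι)) (h3 : ∀ e ∈ D, e.card = 3)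
    (hc : ∀ e ∈ D, c ∈ e) : TT S D = S.d ^ D.card := by
  induction D using Finset.induction_on with
  | empty => simp [TT_empty]
  | insert e D he ih =>
    have hce := hc e (by simp)
    have h1 : (e.erase c).card = 2 := by
      rw [Finset.card_erase_of_mem hce, h3 e (by simp)]
    obtain ⟨u, v, huv, hEq⟩ := Finset.card_eq_two.1 h1
    have hu : u ∈ e.erase c := by rw [hEq]; simp
    have hv : v ∈ e.erase c := by rw [hEq]; simp
    have hee : e = {c, u, v} := by rw [← Finset.insert_erase hce, hEq]
    have hcu : c ≠ u := (Finset.ne_of_mem_erase hu).symm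
    have hcv : c ≠ v := (Finset.ne_of_mem_erase hv).symm
    rw [Finset.card_insert_of_notMem he, pow_succ, mul_comm,
      ← ih (fun e h => h3 e (by simp [h])) (fun e h => hc e (by simp [h]))]
    nth_rewrite 1 [hee]
    apply TT_link S D c u v hcu hcv huv
    rintro e' he' ⟨h1, h2⟩
    apply he
    have : e = e' := by
      apply Finset.eq_of_subset_of_card_le
      · rw [hee]
        intro t; simp only [Finset.mem_insert, Finset.mem_singleton]
        have := hc e' (by simp [he'])
        rintro (rfl | rfl | rfl) <;> assumption
      · rw [h3 e (by simp), h3 e' (by simp [he'])]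
    rw [this]; exact he'

lemma Sys.d_le_one (S : Sys) : S.d ≤ 1 := by
  have := TT_star S (0 : Fin 3) {univ} (by simp) (by simp)
  simp at this
  rw [← this]; exact TT_le_one _ _

end ext

section blow

/-- expectation over a finite type -/
def Ex {α : Type*} [Fintype α] (f : α → ℝ) : ℝ := (∑ a, f a) / (Fintype.card α : ℝ)

lemma Ex_mono {α : Type*} [Fintype α] {f g : α → ℝ} (h : ∀ a, f a ≤ g a) : Ex f ≤ Ex g := by
  unfold Ex; gcongr; exact h _

lemma Ex_nonneg {α : Type*} [Fintype α] {f : α → ℝ} (h : ∀ a, 0 ≤ f a) : 0 ≤ Ex f :=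
  div_nonneg (Finset.sum_nonneg (fun a _ => h a)) (by positivity)

lemma Ex_equiv {α β : Type*} [Fintype α] [Fintype β] (e : α ≃ β) (f : β → ℝ) :
    Ex (fun a => f (e a)) = Ex f := by
  unfold Ex
  rw [Fintype.card_congr e, Equiv.sum_comp e f]

lemma Ex_prod {α β : Type*} [Fintype α] [Fintype β] (f : α × β → ℝ) :
    Ex f = Ex (fun a => Ex (fun b => f (a, b))) := by
  unfold Ex
  rw [Fintype.sum_prod_type, ← Finset.sum_div, div_div, Fintype.card_prod]
  push_cast
  rw [mul_comm]

lemma Ex_comm {α β : Type*} [Fintype α] [Fintype β] (f : α → β → ℝ) :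
    Ex (fun a => Ex (fun b => f a b)) = Ex (fun b => Ex (fun a => f a b)) := by
  unfold Ex
  simp_rw [← Finset.sum_div]
  rw [Finset.sum_comm, div_div, div_div, mul_comm]

lemma Ex_pow {α : Type*} [Fintype α] [Nonempty α] {f : α → ℝ} (h : ∀ a, 0 ≤ f a) (k : ℕ) :
    (Ex f) ^ k ≤ Ex (fun a => f a ^ k) := by
  have hp : (0 : ℝ) < (Fintype.card α : ℝ) := by
    have := Fintype.card_pos (α := α); positivity
  cases k with
  | zero => simp [Ex, hp.ne']
  | succ k =>
    have := pow_sum_div_card_le_sum_pow (s := univ) (f := f) (fun a _ => h a) k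
    unfold Ex
    rw [div_pow, pow_succ (Fintype.card α : ℝ), ← div_div]
    gcongr
    simpa using this

lemma Ex_pi {C α : Type*} [Fintype C] [DecidableEq C] [Fintype α] (h : α → ℝ) :
    Ex (fun y : C → α => ∏ s, h (y s)) = (Ex h) ^ (Fintype.card C) := by
  classical
  unfold Ex
  rw [div_pow]
  congr 1
  · have := Finset.prod_univ_sum (fun _ : C => (univ : Finset α)) (fun _ a => h a)
    simp at this
    rw [this]
  · simp

lemma sidor {V C : Type} [Fintype V] [Nonempty V] [Fintype C] [DecidableEq C] (r : ℕ) :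
    ∀ (Φ : (Fin r → V) → ℝ), (∀ x, 0 ≤ Φ x) →
    (Ex Φ) ^ ((Fintype.card C) ^ r) ≤
      Ex (fun y : Fin r → C → V => ∏ σ : Fin r → C, Φ (fun i => y i (σ i))) := by
  induction r with
  | zero =>
    intro Φ hΦ
    simp [Ex]
    apply le_of_eq
    congr 1
    exact Subsingleton.elim _ _
  | succ r ih =>
    intro Φ hΦ
    have a1 : Ex Φ = Ex (fun v => Ex (fun x : Fin r → V => Φ (Fin.cons v x))) := by
      rw [← Ex_equiv (Fin.consEquiv (fun _ : Fin (r+1) => V)), Ex_prod]; rfl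
    have a2 : Ex (fun y : Fin (r+1) → C → V => ∏ σ : Fin (r+1) → C, Φ (fun i => y i (σ i))) =
        Ex (fun y' : Fin r → C → V => (Ex (fun v => ∏ σ : Fin r → C, Φ (Fin.cons v (fun i => y' i (σ i))))) ^ Fintype.card C) := by
      rw [← Ex_equiv (Fin.consEquiv (fun _ : Fin (r+1) => C → V)), Ex_prod, Ex_comm]
      congr 1
      ext y'
      rw [← Ex_pi]
      congr 1
      ext y0
      rw [← Equiv.prod_comp (Fin.consEquiv (fun _ : Fin (r+1) => C)), Fintype.prod_prod_type]
      refine Finset.prod_congr rfl (fun s _ => Finset.prod_congr rfl (fun σ _ => ?_))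
      congr 1
      ext i
      refine Fin.cases ?_ (fun j => ?_) i <;> simp [Fin.consEquiv]
    rw [a1, a2]
    calc _ ≤ (Ex (fun v => (Ex (fun x : Fin r → V => Φ (Fin.cons v x))) ^ (Fintype.card C ^ r))) ^ Fintype.card C := by
            rw [pow_succ, pow_mul]
            have h0 : 0 ≤ Ex (fun v => Ex (fun x : Fin r → V => Φ (Fin.cons v x))) := Ex_nonneg (fun v => Ex_nonneg (fun x => hΦ _))
            gcongr
            exact Ex_pow (fun v => Ex_nonneg (fun x => hΦ _)) _
      _ ≤ (Ex (fun v => Ex (fun y' : Fin r → C → V => ∏ σ : Fin r → C, Φ (Fin.cons v (fun i => y' i (σ i)))))) ^ Fintype.card C := by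
            have h0 : 0 ≤ Ex (fun v => (Ex (fun x : Fin r → V => Φ (Fin.cons v x))) ^ (Fintype.card C ^ r)) :=
              Ex_nonneg (fun v => pow_nonneg (Ex_nonneg (fun x => hΦ _)) _)
            refine pow_le_pow_left₀ h0 ?_ _
            exact Ex_mono (fun v => ih (fun x => Φ (Fin.cons v x)) (fun x => hΦ _))
      _ ≤ _ := by
            rw [Ex_comm]
            exact Ex_pow (fun y' => Ex_nonneg (fun v => Finset.prod_nonneg (fun σ _ => hΦ _))) _

/-- blow-up of a pattern -/
def bl {r : ℕ} (C : Type) [Fintype C] [DecidableEq C] (D : Finset (Finset (Fin r))) :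
    Finset (Finset (Fin r × C)) :=
  univ.filter (fun e => e.card = 3 ∧ e.image Prod.fst ∈ D)

lemma av_blow {r : ℕ} (H : HG) (C : Type) [Fintype C] [DecidableEq C] [Nonempty C]
    (D : Finset (Finset (Fin r))) :
    (av H (ind D)) ^ ((Fintype.card C) ^ r) ≤ av H (ind (bl C D)) := by
  classical
  have : Nonempty H.V := Fintype.card_pos_iff.1 H.pos
  have e1 : av H (ind D) = Ex (fun x : Fin r → H.V => ind D (pat H x)) := by
    unfold av Ex; simp
  have e2 : av H (ind (bl C D)) = Ex (fun x : Fin r × C → H.V => ind (bl C D) (pat H x)) := by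
    unfold av Ex; simp
  rw [e1, e2, ← Ex_equiv (Equiv.curry (Fin r) C H.V).symm]
  refine (sidor (C := C) r (fun x : Fin r → H.V => ind D (pat H x)) (fun x => ind_nonneg _ _)).trans ?_
  apply Ex_mono
  intro y
  by_cases hall : ∀ σ : Fin r → C, D ⊆ pat H (fun i => y i (σ i))
  · have : bl C D ⊆ pat H ((Equiv.curry (Fin r) C H.V).symm y) := by
      rw [subset_pat]
      intro e he
      simp only [bl, Finset.mem_filter, Finset.mem_univ, true_and] at he
      refine ⟨he.1, ?_⟩
      have hc3 : (e.image Prod.fst).card = 3 := by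
        have := hall (fun _ => Classical.arbitrary C)
        rw [subset_pat] at this
        exact (this _ he.2).1
      have hinj : Set.InjOn Prod.fst (e : Set (Fin r × C)) := by
        apply Finset.injOn_of_card_image_eq
        rw [hc3, he.1]
      let σ : Fin r → C := fun i => if h : ∃ q ∈ e, q.1 = i then h.choose.2 else Classical.arbitrary C
      have hσ : ∀ q ∈ e, σ q.1 = q.2 := by
        intro q hq
        have hex : ∃ q' ∈ e, q'.1 = q.1 := ⟨q, hq, rfl⟩
        simp only [σ, dif_pos hex]
        rw [hinj hex.choose_spec.1 hq hex.choose_spec.2]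
      have := hall σ
      rw [subset_pat] at this
      have h2 := (this _ he.2).2
      rw [Finset.image_image] at h2
      convert h2 using 1
      apply Finset.image_congr
      intro q hq
      simp [hσ q hq, Equiv.curry]
      rfl
    rw [show ind (bl C D) (pat H ((Equiv.curry (Fin r) C H.V).symm y)) = 1 from if_pos this]
    exact Finset.prod_le_one (fun _ _ => ind_nonneg _ _) (fun _ _ => ind_le_one _ _)
  · push Not at hall
    obtain ⟨σ, hσ⟩ := hall
    rw [Finset.prod_eq_zero (mem_univ σ)]
    · exact ind_nonneg _ _
    · simp [ind, hσ]

lemma TT_blow {r : ℕ} (S : Sys) (C : Type) [Fintype C] [DecidableEq C] [Nonempty C]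
    (D : Finset (Finset (Fin r))) (hD : 0 < TT S D) : 0 < TT S (bl C D) := by
  have : (TT S D) ^ ((Fintype.card C) ^ r) ≤ TT S (bl C D) :=
    le_of_tendsto_of_tendsto' ((Lf_tendsto S (ind D)).pow _) (Lf_tendsto S _)
      (fun k => av_blow (S.H k) C D)
  exact lt_of_lt_of_le (by positivity) this

end blow

section process
variable {r : ℕ} {C : Type} [Fintype C] [DecidableEq C]

/-- two clones in block `c` -/
def cl (c : Fin r) (p : Finset C) : Finset (Fin r × C) := p.image (fun j => (c, j))

lemma mem_cl (c : Fin r) (p : Finset C) (z : Fin r × C) : z ∈ cl c p ↔ z.1 = c ∧ z.2 ∈ p := by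
  unfold cl
  simp only [Finset.mem_image]
  constructor
  · rintro ⟨j, hj, rfl⟩; exact ⟨rfl, hj⟩
  · rintro ⟨rfl, h⟩; exact ⟨z.2, h, rfl⟩

lemma card_cl (c : Fin r) (p : Finset C) : (cl c p).card = p.card := by
  unfold cl
  apply Finset.card_image_of_injective
  intro i j h; simpa using h

/-- all of block `x` is joined to the pair `p` of block `c` -/
def R1 (D : Finset (Finset (Fin r × C))) (A : Fin r → Finset C) (c : Fin r) (p : Finset C)
    (x : Fin r) : Prop := ∀ i ∈ A x, insert (x, i) (cl c p) ∈ D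

lemma R1_mono {D D' : Finset (Finset (Fin r × C))} {A A' : Fin r → Finset C} {c : Fin r}
    {p : Finset C} {x : Fin r} (h : R1 D A c p x) (hD : D ⊆ D') (hA : A' x ⊆ A x) :
    R1 D' A' c p x := fun i hi => hD (h i (hA hi))

lemma weight_sum (A : Fin r → Finset C) (T : Finset (Fin r)) (W : Finset (Fin r × C)) :
    ∑ z ∈ W, (if z.1 ∈ T ∧ z.2 ∈ A z.1 then 1 / ((A z.1).card : ℝ) else 0) =
      ∑ x ∈ T, (((A x).filter (fun i => (x, i) ∈ W)).card : ℝ) / (A x).card := by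
  have h0 : ∑ z ∈ W, (if z.1 ∈ T ∧ z.2 ∈ A z.1 then 1 / ((A z.1).card : ℝ) else 0) =
      ∑ z : Fin r × C, if z ∈ W then (if z.1 ∈ T ∧ z.2 ∈ A z.1 then 1 / ((A z.1).card : ℝ) else 0) else 0 := by
    conv_rhs => rw [← Finset.sum_filter, Finset.filter_univ_mem]
  rw [h0]
  rw [Fintype.sum_prod_type, ← Finset.sum_subset (Finset.subset_univ T)]
  · refine Finset.sum_congr rfl (fun x hx => ?_)
    rw [Finset.card_filter, Nat.cast_sum, Finset.sum_div, ← Finset.sum_subset (Finset.subset_univ (A x))]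
    · refine Finset.sum_congr rfl (fun i hi => ?_)
      by_cases h : (x, i) ∈ W <;> simp [h, hx, hi]
    · intro i _ hi; simp [hi]
  · intro x _ hx; simp [hx]

/-- the two-out-of-three property -/
def Two (Q : Fin r → Prop) (a b e : Fin r) : Prop := (Q a ∧ Q b) ∨ (Q a ∧ Q e) ∨ (Q b ∧ Q e)

lemma one_pair (S : Sys) (η : ℝ) (hη : 0 < η) (hη1 : η ≤ 1) (hd : S.d = 1/3 + η) (c : Fin r)
    (p : Finset C) (hp : p.card = 2) (D : Finset (Finset (Fin r × C))) (A : Fin r → Finset C)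
    (hD : 0 < TT S D) (hA : ∀ x, (A x).Nonempty) (hcl : ∀ e ∈ D, ¬ cl c p ⊆ e)
    (a b e : Fin r) (hab : a ≠ b) (hae : a ≠ e) (hbe : b ≠ e) (hac : a ≠ c) (hbc : b ≠ c) (hec : e ≠ c) :
    ∃ D' A', D ⊆ D' ∧ 0 < TT S D' ∧ (∀ x, A' x ⊆ A x) ∧ A' c = A c ∧
      (∀ x, η * ((A x).card : ℝ) ≤ (A' x).card) ∧
      (∀ f ∈ D', f ∈ D ∨ ∃ z : Fin r × C, z.1 ≠ c ∧ f = insert z (cl c p)) ∧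
      Two (R1 D' A' c p) a b e := by
  classical
  set T : Finset (Fin r) := {a, b, e} with hT
  have hcT : c ∉ T := by simp [hT, hac.symm, hbc.symm, hec.symm]
  have hpos : ∀ x, (0 : ℝ) < (A x).card := fun x => by have := (hA x).card_pos; positivity
  have hsumT : ∀ f : Fin r → ℝ, ∑ x ∈ T, f x = f a + f b + f e := by
    intro f
    rw [hT, Finset.sum_insert (by simp [hab, hae]), Finset.sum_pair hbe]; ring
  obtain ⟨W, hW1, hW2, hW3⟩ := ext_step S D hD (cl c p) (by rw [card_cl, hp]) hcl
    (fun z => if z.1 ∈ T ∧ z.2 ∈ A z.1 then 1 / ((A z.1).card : ℝ) else 0) (by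
      intro z hz
      rw [mem_cl] at hz
      simp [hz.1, hcT])
  rw [weight_sum, weight_sum, hsumT, hsumT] at hW2
  simp only [Finset.mem_univ, Finset.filter_true] at hW2
  rw [div_self (hpos a).ne', div_self (hpos b).ne', div_self (hpos e).ne'] at hW2
  set α : Fin r → ℝ := fun x => (((A x).filter (fun i => (x, i) ∈ W)).card : ℝ) / (A x).card with hα
  have hα1 : ∀ x, α x ≤ 1 := fun x => by
    rw [hα]; simp only
    rw [div_le_one (hpos x)]
    exact_mod_cast Finset.card_filter_le _ _
  have hsum : 1 + 3 * η ≤ α a + α b + α e := by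
    simp only [hα]; rw [hd] at hW2; linarith
  have hR : ∀ x, x ∈ T → η ≤ α x → R1 (D ∪ W.image (fun z => insert z (cl c p)))
      (fun x => if x ∈ T ∧ η ≤ α x then (A x).filter (fun i => (x, i) ∈ W) else A x) c p x := by
    intro x hx hx2 i hi
    simp only [if_pos (And.intro hx hx2), Finset.mem_filter] at hi
    exact Finset.mem_union_right _ (Finset.mem_image_of_mem (fun z => insert z (cl c p)) hi.2)
  refine ⟨D ∪ W.image (fun z => insert z (cl c p)),
    fun x => if x ∈ T ∧ η ≤ α x then (A x).filter (fun i => (x, i) ∈ W) else A x,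
    Finset.subset_union_left, hW3, ?_, ?_, ?_, ?_, ?_⟩
  · intro x
    simp only
    split_ifs
    · exact Finset.filter_subset _ _
    · exact Finset.Subset.refl _
  · simp [hcT]
  · intro x
    simp only
    split_ifs with h
    · have := h.2
      simp only [hα] at this
      rwa [le_div_iff₀ (hpos x)] at this
    · nlinarith [hpos x]
  · intro f hf
    rw [Finset.mem_union, Finset.mem_image] at hf
    rcases hf with hf | ⟨z, hz, rfl⟩
    · exact Or.inl hf
    · refine Or.inr ⟨z, ?_, rfl⟩
      intro hzc
      apply hW1 z hz
      simp [hzc, hcT]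
  · have ha := hR a (by simp [hT])
    have hb := hR b (by simp [hT])
    have he := hR e (by simp [hT])
    unfold Two
    by_cases h1 : η ≤ α a <;> by_cases h2 : η ≤ α b
    · exact Or.inl ⟨ha h1, hb h2⟩
    · have h3 : η ≤ α e := by push Not at h2; by_contra h3; linarith [hα1 a]
      exact Or.inr (Or.inl ⟨ha h1, he h3⟩)
    · have h3 : η ≤ α e := by push Not at h1; by_contra h3; linarith [hα1 b]
      exact Or.inr (Or.inr ⟨hb h2, he h3⟩)
    · push Not at h1 h2; linarith [hα1 e]

lemma Two_mono {Q Q' : Fin r → Prop} {a b e : Fin r} (h : Two Q a b e) (hQ : ∀ x, Q x → Q' x) :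
    Two Q' a b e := by
  unfold Two at *
  have := hQ a; have := hQ b; have := hQ e
  tauto

lemma process (S : Sys) (η : ℝ) (hη : 0 < η) (hη1 : η ≤ 1) (hd : S.d = 1/3 + η) (c : Fin r)
    (τ : Finset C → Fin r × Fin r × Fin r) (P : Finset (Finset C)) :
    (∀ p ∈ P, p.card = 2) → ∀ (D : Finset (Finset (Fin r × C))) (A : Fin r → Finset C),
    0 < TT S D → (∀ x, (A x).Nonempty) → (∀ p ∈ P, ∀ e ∈ D, ¬ cl c p ⊆ e) →
    ∃ D' A', D ⊆ D' ∧ 0 < TT S D' ∧ (∀ x, A' x ⊆ A x) ∧ A' c = A c ∧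
      (∀ x, η ^ P.card * ((A x).card : ℝ) ≤ (A' x).card) ∧
      (∀ f ∈ D', f ∈ D ∨ ∃ p ∈ P, ∃ z : Fin r × C, z.1 ≠ c ∧ f = insert z (cl c p)) ∧
      ∀ p ∈ P, ∀ a b e : Fin r, τ p = (a, b, e) → a ≠ b → a ≠ e → b ≠ e → a ≠ c → b ≠ c → e ≠ c →
        Two (R1 D' A' c p) a b e := by
  classical
  induction P using Finset.induction_on with
  | empty =>
    intro _ D A hD hA _
    exact ⟨D, A, Finset.Subset.refl _, hD, fun _ => Finset.Subset.refl _, rfl, by simp, fun f hf => Or.inl hf, by simp⟩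
  | insert p P hpP ih =>
    intro h2 D A hD hA hcl
    obtain ⟨D1, A1, hDD, hD1, hAA, hAc, hsz, hnew, hR⟩ := ih (fun q hq => h2 q (by simp [hq])) D A hD hA
      (fun q hq => hcl q (by simp [hq]))
    have hA1 : ∀ x, (A1 x).Nonempty := by
      intro x
      rw [← Finset.card_pos]
      have h0 : (0 : ℝ) < η ^ P.card * ((A x).card : ℝ) := by
        have := (hA x).card_pos; positivity
      exact_mod_cast lt_of_lt_of_le h0 (hsz x)
    rw [Finset.card_insert_of_notMem hpP]
    by_cases hv : ∃ a b e, τ p = (a, b, e) ∧ a ≠ b ∧ a ≠ e ∧ b ≠ e ∧ a ≠ c ∧ b ≠ c ∧ e ≠ c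
    · obtain ⟨a, b, e, hτ, hab, hae, hbe, hac, hbc, hec⟩ := hv
      obtain ⟨D2, A2, hDD2, hD2, hAA2, hAc2, hsz2, hnew2, hR2⟩ := one_pair S η hη hη1 hd c p (h2 p (by simp)) D1 A1 hD1 hA1 (by
        intro f hf hsub
        rcases hnew f hf with hf | ⟨q, hq, z, hz, rfl⟩
        · exact hcl p (by simp) f hf hsub
        · have : p ⊆ q := by
            intro j hj
            have h1 : (c, j) ∈ insert z (cl c q) := hsub (by rw [mem_cl]; exact ⟨rfl, hj⟩)
            rw [Finset.mem_insert, mem_cl] at h1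
            rcases h1 with h1 | h1
            · exact absurd (by rw [← h1]) hz
            · exact h1.2
          have := Finset.eq_of_subset_of_card_le this (by rw [h2 p (by simp), h2 q (by simp [hq])])
          rw [this] at hpP; exact hpP hq) a b e hab hae hbe hac hbc hec
      refine ⟨D2, A2, hDD.trans hDD2, hD2, fun x => (hAA2 x).trans (hAA x), hAc2.trans hAc, ?_, ?_, ?_⟩
      · intro x
        calc η ^ (P.card + 1) * ((A x).card : ℝ) = η * (η ^ P.card * ((A x).card : ℝ)) := by ring
          _ ≤ η * (A1 x).card := by gcongr; exact hsz x
          _ ≤ _ := hsz2 x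
      · intro f hf
        rcases hnew2 f hf with hf | ⟨z, hz, rfl⟩
        · rcases hnew f hf with hf | ⟨q, hq, z, hz, rfl⟩
          · exact Or.inl hf
          · exact Or.inr ⟨q, by simp [hq], z, hz, rfl⟩
        · exact Or.inr ⟨p, by simp, z, hz, rfl⟩
      · intro q hq a' b' e' hτ' g1 g2 g3 g4 g5 g6
        rw [Finset.mem_insert] at hq
        rcases hq with rfl | hq
        · rw [hτ] at hτ'
          simp only [Prod.mk.injEq] at hτ'
          obtain ⟨rfl, rfl, rfl⟩ := hτ'
          exact hR2
        · exact Two_mono (hR q hq a' b' e' hτ' g1 g2 g3 g4 g5 g6) (fun x hx => R1_mono hx hDD2 (hAA2 x))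
    · refine ⟨D1, A1, hDD, hD1, hAA, hAc, ?_, ?_, ?_⟩
      · intro x
        refine le_trans ?_ (hsz x)
        gcongr ?_ * _
        exact pow_le_pow_of_le_one hη.le hη1 (by omega)
      · intro f hf
        rcases hnew f hf with hf | ⟨q, hq, z, hz, rfl⟩
        · exact Or.inl hf
        · exact Or.inr ⟨q, by simp [hq], z, hz, rfl⟩
      · intro q hq a' b' e' hτ' g1 g2 g3 g4 g5 g6
        rw [Finset.mem_insert] at hq
        rcases hq with rfl | hq
        · exact absurd ⟨a', b', e', hτ', g1, g2, g3, g4, g5, g6⟩ hv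
        · exact hR q hq a' b' e' hτ' g1 g2 g3 g4 g5 g6

lemma hered {U K : Type} [DecidableEq U] [Fintype K] [DecidableEq K] (Pr : K → Finset U → Prop)
    (κ : ℝ) (hκ : 0 < κ) (hκ1 : κ ≤ 1) (hmono : ∀ k X Y, X ⊆ Y → Pr k X → Pr k Y) (X : Finset U) :
    ∃ X' ⊆ X, κ ^ (Fintype.card K) * (X.card : ℝ) ≤ X'.card ∧
      ∀ k, Pr k X' → ∀ Y ⊆ X', κ * (X'.card : ℝ) ≤ Y.card → Pr k Y := by
  classical
  have main : ∀ m : ℕ, ∀ X : Finset U, (univ.filter (fun k => Pr k X)).card ≤ m →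
      ∃ X' ⊆ X, κ ^ m * (X.card : ℝ) ≤ X'.card ∧
      ∀ k, Pr k X' → ∀ Y ⊆ X', κ * (X'.card : ℝ) ≤ Y.card → Pr k Y := by
    intro m
    induction m with
    | zero =>
      intro X hX
      refine ⟨X, Finset.Subset.refl _, by simp, fun k hk => ?_⟩
      have : k ∈ univ.filter (fun k => Pr k X) := by simp [hk]
      rw [Nat.le_zero, Finset.card_eq_zero] at hX
      rw [hX] at this; simp at this
    | succ m ih =>
      intro X hX
      by_cases hg : ∀ k, Pr k X → ∀ Y ⊆ X, κ * (X.card : ℝ) ≤ Y.card → Pr k Y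
      · refine ⟨X, Finset.Subset.refl _, ?_, hg⟩
        have : κ ^ (m+1) ≤ 1 := pow_le_one₀ hκ.le hκ1
        nlinarith [(Nat.cast_nonneg X.card : (0:ℝ) ≤ X.card)]
      · push Not at hg
        obtain ⟨k, hk, Y, hY, hYc, hkY⟩ := hg
        have hlt : (univ.filter (fun k => Pr k Y)).card < (univ.filter (fun k => Pr k X)).card := by
          apply Finset.card_lt_card
          rw [Finset.ssubset_iff_of_subset]
          · exact ⟨k, by simp [hk], by simp [hkY]⟩
          · intro k' hk'
            simp at hk' ⊢
            exact hmono k' Y X hY hk'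
        obtain ⟨X', hX', hc, hh⟩ := ih Y (by omega)
        refine ⟨X', hX'.trans hY, ?_, hh⟩
        calc κ ^ (m+1) * (X.card : ℝ) = κ ^ m * (κ * X.card) := by ring
          _ ≤ κ ^ m * Y.card := by gcongr
          _ ≤ _ := hc
  exact main _ X (Finset.card_le_univ _)

end process

section main_ind

/-- mark -/
def Mk {r : ℕ} {C : Type} [Fintype C] [DecidableEq C] (D : Finset (Finset (Fin r × C)))
    (A : Fin r → Finset C) (c a b : Fin r) : Prop :=
  ∃ p : Finset C, p ⊆ A c ∧ p.card = 2 ∧ R1 D A c p a ∧ R1 D A c p b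

/-- `D` contains no two clones of block `c` in one edge -/
def Cln {r : ℕ} {C : Type} [Fintype C] [DecidableEq C] (D : Finset (Finset (Fin r × C)))
    (c : Fin r) : Prop :=
  ∀ p : Finset C, p.card = 2 → ∀ e ∈ D, ¬ cl c p ⊆ e

lemma line_pair {Tt : Type} [Fintype Tt] [DecidableEq Tt] (q : ℕ) (t : Tt)
    (Y : Finset (Tt → Fin q)) (hY : q ^ (Fintype.card Tt - 1) < Y.card) :
    ∃ u ∈ Y, ∃ v ∈ Y, u ≠ v ∧ ∀ t', t' ≠ t → u t' = v t' := by
  have := Finset.exists_ne_map_eq_of_card_lt_of_maps_to (s := Y)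
    (t := (univ : Finset ({t' : Tt // t' ≠ t} → Fin q)))
    (f := fun u t' => u t'.1) (by
      rw [Finset.card_univ, Fintype.card_fun, Fintype.card_fin]
      convert hY using 2
      simp) (by intro u _; simp)
  obtain ⟨u, hu, v, hv, huv, h⟩ := this
  exact ⟨u, hu, v, hv, huv, fun t' ht' => congrFun h ⟨t', ht'⟩⟩

set_option maxHeartbeats 2000000 in
lemma main_step (S : Sys) (η : ℝ) (hη : 0 < η) (hη1 : η ≤ 1) (hd : S.d = 1/3 + η) (r : ℕ) (s : ℕ) :
    ∃ κ : ℝ, 0 < κ ∧ κ ≤ 1 ∧ ∃ N : ℕ, ∀ (C : Type) [Fintype C] [DecidableEq C] (R : Finset (Fin r)),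
      R.card = s → ∀ (D : Finset (Finset (Fin r × C))) (A : Fin r → Finset C),
      0 < TT S D → (∀ x, (A x).Nonempty) → (∀ c ∈ R, N ≤ (A c).card) → (∀ c ∈ R, Cln D c) →
      ∃ D' A', D ⊆ D' ∧ 0 < TT S D' ∧ (∀ x, A' x ⊆ A x) ∧ (∀ x, (A' x).Nonempty) ∧
        (∀ a, a ∉ R → κ * ((A a).card : ℝ) ≤ (A' a).card) ∧
        ∀ c ∈ R, ∀ a b e : Fin r, a ≠ b → a ≠ e → b ≠ e → a ≠ c → b ≠ c → e ≠ c →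
          Mk D' A' c a b ∨ Mk D' A' c a e ∨ Mk D' A' c b e := by
  classical
  induction s with
  | zero =>
    refine ⟨1, one_pos, le_refl _, 0, ?_⟩
    intro C _ _ R hR D A hD hA _ _
    rw [Finset.card_eq_zero] at hR
    subst hR
    exact ⟨D, A, Finset.Subset.refl _, hD, fun _ => Finset.Subset.refl _, hA, by simp, by simp⟩
  | succ s ih =>
    obtain ⟨κ, hκ, hκ1, N, hN⟩ := ih
    set K := Fin r × Fin r with hK
    set Tt := Fin r × Fin r × Fin r with hTt
    have hκK : 0 < κ ^ Fintype.card K := by positivity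
    obtain ⟨q, hq⟩ := exists_nat_gt (1 / κ ^ Fintype.card K)
    rw [div_lt_iff₀ hκK] at hq
    set Q := q ^ Fintype.card Tt with hQ
    set M0 := 2 ^ Q with hM0
    have hηM : 0 < η ^ M0 := by positivity
    obtain ⟨N1, hN1⟩ := exists_nat_gt ((N : ℝ) / η ^ M0)
    rw [div_lt_iff₀ hηM] at hN1
    refine ⟨κ * η ^ M0, by positivity, mul_le_one₀ hκ1 hηM.le (pow_le_one₀ hη.le hη1), max Q N1, ?_⟩
    intro C _ _ R hR D A hD hA hbig hcln
    obtain ⟨c, hc⟩ : R.Nonempty := by rw [← Finset.card_pos]; omega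
    have hTpos : 0 < Fintype.card Tt := Fintype.card_pos_iff.2 ⟨(c, c, c)⟩
    have hAc : Q ≤ (A c).card := (le_max_left _ _).trans (hbig c hc)
    -- embed the cube
    obtain ⟨X0, hX0, hX0c⟩ := Finset.exists_subset_card_eq hAc
    have hcardeq : Fintype.card (Tt → Fin q) = Fintype.card X0 := by
      simp [hX0c, hQ]
    let g0 : (Tt → Fin q) ≃ X0 := Fintype.equivOfCardEq hcardeq
    let g : (Tt → Fin q) → C := fun u => (g0 u).1
    have hginj : Function.Injective g := fun u v h => g0.injective (Subtype.ext h)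
    have hgX : ∀ u, g u ∈ X0 := fun u => (g0 u).2
    have hgsurj : ∀ x ∈ X0, ∃ u, g u = x := fun x hx => ⟨g0.symm ⟨x, hx⟩, by simp [g]⟩
    let Line : Finset C → Tt → Prop := fun p t => ∃ u v : Tt → Fin q, u ≠ v ∧ (∀ t', t' ≠ t → u t' = v t') ∧ p = {g u, g v}
    have hLine : ∀ p t t', Line p t → Line p t' → t = t' := by
      rintro p t t' ⟨u, v, huv, h1, rfl⟩ ⟨u', v', huv', h1', h2⟩
      by_contra hne
      apply huv
      have hsame : ∀ s, s ≠ t' → u s = v s := by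
        intro s hs
        have hu : g u ∈ ({g u', g v'} : Finset C) := by rw [← h2]; simp
        have hv : g v ∈ ({g u', g v'} : Finset C) := by rw [← h2]; simp
        simp only [Finset.mem_insert, Finset.mem_singleton, hginj.eq_iff] at hu hv
        have := h1' s hs
        rcases hu with rfl | rfl <;> rcases hv with rfl | rfl <;> simp [this]
      funext s
      by_cases hs : s = t
      · subst hs; exact hsame s hne
      · exact h1 s hs
    let τ : Finset C → Tt := fun p => if h : ∃ t, Line p t then h.choose else (c, c, c)
    have hτ : ∀ p t, Line p t → τ p = t := by
      intro p t h
      have hex : ∃ t, Line p t := ⟨t, h⟩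
      simp only [τ, dif_pos hex]
      exact hLine p _ _ hex.choose_spec h
    let P : Finset (Finset C) := X0.powerset.filter (fun p => ∃ t, Line p t)
    have hP2 : ∀ p ∈ P, p.card = 2 := by
      intro p hp
      simp only [P, Finset.mem_filter] at hp
      obtain ⟨_, t, u, v, huv, _, rfl⟩ := hp
      exact Finset.card_pair (fun h => huv (hginj h))
    have hPc : P.card ≤ M0 := by
      refine (Finset.card_filter_le _ _).trans ?_
      rw [Finset.card_powerset, hX0c]
    obtain ⟨D1, A1, hDD1, hD1, hAA1, hAc1, hsz1, hnew1, hR1⟩ :=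
      process S η hη hη1 hd c τ P hP2 D A hD hA (fun p hp => hcln c hc p (hP2 p hp))
    have hsz1' : ∀ x, η ^ M0 * ((A x).card : ℝ) ≤ (A1 x).card := by
      intro x
      refine le_trans ?_ (hsz1 x)
      gcongr ?_ * _
      exact pow_le_pow_of_le_one hη.le hη1 hPc
    have hA1 : ∀ x, (A1 x).Nonempty := by
      intro x
      rw [← Finset.card_pos]
      have h0 : (0 : ℝ) < η ^ M0 * ((A x).card : ℝ) := by
        have := (hA x).card_pos; positivity
      exact_mod_cast lt_of_lt_of_le h0 (hsz1' x)
    obtain ⟨X', hX'X, hX'c, hher⟩ := hered (K := K)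
      (fun k X => ∃ p : Finset C, p ⊆ X ∧ p.card = 2 ∧ R1 D1 A1 c p k.1 ∧ R1 D1 A1 c p k.2) κ hκ hκ1
      (by rintro k X Y hXY ⟨p, hp, h⟩; exact ⟨p, hp.trans hXY, h⟩) X0
    have hX'big : q ^ (Fintype.card Tt - 1) < X'.card := by
      have h1 : (q : ℝ) ^ (Fintype.card Tt - 1) < X'.card := by
        refine lt_of_lt_of_le ?_ hX'c
        rw [hX0c, hQ]
        push_cast
        obtain ⟨m, hm⟩ : ∃ m, Fintype.card Tt = m + 1 := ⟨Fintype.card Tt - 1, by omega⟩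
        rw [hm]
        simp only [Nat.add_sub_cancel]
        have hq0 : (0 : ℝ) < q := by
          rcases (Nat.cast_nonneg q : (0 : ℝ) ≤ q).eq_or_lt with h | h
          · rw [← h] at hq; norm_num at hq
          · exact h
        rw [pow_succ]
        have : (0 : ℝ) < (q : ℝ) ^ m := by positivity
        nlinarith
      exact_mod_cast h1
    set A2 : Fin r → Finset C := Function.update A1 c X' with hA2
    have hA2c : A2 c = X' := by simp [hA2]
    have hA2x : ∀ x, x ≠ c → A2 x = A1 x := fun x hx => by simp [hA2, hx]
    have hX'ne : X'.Nonempty := by rw [← Finset.card_pos]; omega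
    have hA2A : ∀ x, A2 x ⊆ A x := by
      intro x
      by_cases hx : x = c
      · subst hx; rw [hA2c]; exact hX'X.trans hX0
      · rw [hA2x x hx]; exact hAA1 x
    obtain ⟨D3, A3, hDD3, hD3, hAA3, hA3, hsz3, hmk3⟩ := hN C (R.erase c)
      (by rw [Finset.card_erase_of_mem hc]; omega) D1 A2 hD1
      (by
        intro x
        by_cases hx : x = c
        · subst hx; rw [hA2c]; exact hX'ne
        · rw [hA2x x hx]; exact hA1 x)
      (by
        intro c' hc'
        rw [Finset.mem_erase] at hc'
        rw [hA2x c' hc'.1]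
        have h1 : (N1 : ℝ) ≤ (A c').card := by exact_mod_cast (le_max_right _ _).trans (hbig c' hc'.2)
        have h2 : (N : ℝ) ≤ (A1 c').card := by
          have := hsz1' c'
          nlinarith
        exact_mod_cast h2)
      (by
        intro c' hc' p hp e he hsub
        rw [Finset.mem_erase] at hc'
        rcases hnew1 e he with he | ⟨p', hp', z, hz, rfl⟩
        · exact hcln c' hc'.2 p hp e he hsub
        · have : cl c' p ⊆ {z} := by
            intro w hw
            have h1 := hsub hw
            rw [Finset.mem_insert] at h1
            rcases h1 with h1 | h1
            · simp [h1]
            · rw [mem_cl] at h1 hw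
              exact absurd (hw.1.symm.trans h1.1) hc'.1
          have := Finset.card_le_card this
          rw [card_cl, hp] at this
          simp at this)
    refine ⟨D3, A3, hDD1.trans hDD3, hD3, fun x => (hAA3 x).trans (hA2A x), hA3, ?_, ?_⟩
    · intro a ha
      have hac : a ≠ c := by rintro rfl; exact ha hc
      have h1 := hsz3 a (fun h => ha (Finset.mem_of_mem_erase h))
      rw [hA2x a hac] at h1
      have h2 := hsz1' a
      calc κ * η ^ M0 * ((A a).card : ℝ) = κ * (η ^ M0 * (A a).card) := by ring
        _ ≤ κ * (A1 a).card := by gcongr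
        _ ≤ _ := h1
    · intro c' hc' a b e hab hae hbe hac hbc hec
      by_cases hcc : c' = c
      · subst hcc
        have hA3X : A3 c' ⊆ X' := by rw [← hA2c]; exact hAA3 c'
        have hA3s : κ * (X'.card : ℝ) ≤ (A3 c').card := by
          have := hsz3 c' (by simp)
          rwa [hA2c] at this
        have trans : ∀ a b : Fin r, a ≠ c' → b ≠ c' → (∃ p : Finset C, p ⊆ X' ∧ p.card = 2 ∧ R1 D1 A1 c' p a ∧ R1 D1 A1 c' p b) →
            Mk D3 A3 c' a b := by
          intro a b ha hb h
          obtain ⟨p, hp1, hp2, hp3, hp4⟩ := hher (a, b) h (A3 c') hA3X hA3s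
          exact ⟨p, hp1, hp2, R1_mono hp3 hDD3 (by rw [← hA2x a ha]; exact hAA3 a),
            R1_mono hp4 hDD3 (by rw [← hA2x b hb]; exact hAA3 b)⟩
        obtain ⟨u, hu, v, hv, huv, hline⟩ := line_pair q (a, b, e) (univ.filter (fun u => g u ∈ X')) (by
          refine lt_of_lt_of_le hX'big ?_
          rw [← Finset.card_image_of_injective _ hginj]
          apply Finset.card_le_card
          intro x hx
          obtain ⟨u, rfl⟩ := hgsurj x (hX'X hx)
          exact Finset.mem_image_of_mem g (by simp [hx]))
        simp only [Finset.mem_filter, Finset.mem_univ, true_and] at hu hv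
        have hL : Line {g u, g v} (a, b, e) := ⟨u, v, huv, hline, rfl⟩
        have hsubX : ({g u, g v} : Finset C) ⊆ X' := by
          intro x; simp only [Finset.mem_insert, Finset.mem_singleton]; rintro (rfl | rfl) <;> assumption
        have hPm : ({g u, g v} : Finset C) ∈ P := by
          simp only [P, Finset.mem_filter, Finset.mem_powerset]
          exact ⟨hsubX.trans hX'X, _, hL⟩
        have h2 := hR1 _ hPm a b e (hτ _ _ hL) hab hae hbe hac hbc hec
        have hc2 := hP2 _ hPm
        rcases h2 with h | h | h
        · exact Or.inl (trans a b hac hbc ⟨_, hsubX, hc2, h⟩)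
        · exact Or.inr (Or.inl (trans a e hac hec ⟨_, hsubX, hc2, h⟩))
        · exact Or.inr (Or.inr (trans b e hbc hec ⟨_, hsubX, hc2, h⟩))
      · exact hmk3 c' (Finset.mem_erase.2 ⟨hcc, hc'⟩) a b e hab hae hbe hac hbc hec

end main_ind

section marks
variable {r : ℕ} {C : Type} [Fintype C] [DecidableEq C]

lemma TT_K5' {ι : Type} [Fintype ι] [DecidableEq ι] (S : Sys) (D : Finset (Finset ι)) (g : Fin 5 → ι)
    (h01 : {g 0, g 1, g 2} ∈ D) (h02 : {g 0, g 3, g 4} ∈ D)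
    (h03 : {g 0, g 1, g 3} ∈ D) (h04 : {g 0, g 1, g 4} ∈ D)
    (h05 : {g 0, g 2, g 3} ∈ D) (h06 : {g 0, g 2, g 4} ∈ D)
    (h07 : {g 1, g 3, g 4} ∈ D) (h08 : {g 2, g 3, g 4} ∈ D)
    (h09 : {g 3, g 1, g 2} ∈ D) (h10 : {g 4, g 1, g 2} ∈ D) : ¬ 0 < TT S D := by
  apply TT_K5 S D g
  have key : ∀ s : Finset (Fin 5), s.card = 3 → s = {0,1,2} ∨ s = {0,3,4} ∨ s = {0,1,3} ∨ s = {0,1,4} ∨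
      s = {0,2,3} ∨ s = {0,2,4} ∨ s = {1,3,4} ∨ s = {2,3,4} ∨ s = {3,1,2} ∨ s = {4,1,2} := by decide
  intro a b c hab hac hbc
  have h3 : ({a, b, c} : Finset (Fin 5)).card = 3 := Finset.card_eq_three.2 ⟨a, b, c, hab, hac, hbc, rfl⟩
  have him : ({g a, g b, g c} : Finset ι) = ({a, b, c} : Finset (Fin 5)).image g := by
    simp [Finset.image_insert]
  rw [him]
  rcases key _ h3 with h | h | h | h | h | h | h | h | h | h <;> rw [h] <;>
    simpa [Finset.image_insert]

lemma no_two_marks (S : Sys) (F : Finset (Finset (Fin r)))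
    (D : Finset (Finset (Fin r × C))) (A : Fin r → Finset C) (hD : 0 < TT S D) (hFD : bl C F ⊆ D)
    (hA : ∀ x, (A x).Nonempty) (a b c : Fin r) (hab : a ≠ b) (hac : a ≠ c) (hbc : b ≠ c)
    (hF : ({a, b, c} : Finset (Fin r)) ∈ F) (h1 : Mk D A c a b) (h2 : Mk D A a b c) : False := by
  obtain ⟨p, hpA, hp2, hpa, hpb⟩ := h1
  obtain ⟨p', hpA', hp2', hpb', hpc'⟩ := h2
  obtain ⟨u, v, huv, rfl⟩ := Finset.card_eq_two.1 hp2
  obtain ⟨i, j, hij, rfl⟩ := Finset.card_eq_two.1 hp2'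
  obtain ⟨h, hh⟩ := hA b
  have hF' : ∀ x y : C, ({(b, h), (a, x), (c, y)} : Finset (Fin r × C)) ∈ D := by
    intro x y
    apply hFD
    simp only [bl, Finset.mem_filter, Finset.mem_univ, true_and]
    refine ⟨Finset.card_eq_three.2 ⟨_, _, _, ?_, ?_, ?_, rfl⟩, ?_⟩
    · simp [hab.symm]
    · simp [hbc]
    · simp [hac]
    · simp only [Finset.image_insert, Finset.image_singleton]
      rwa [Finset.insert_comm]
  refine TT_K5' S D ![(b, h), (a, i), (a, j), (c, u), (c, v)] ?_ ?_ ?_ ?_ ?_ ?_ ?_ ?_ ?_ ?_ hD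
  · simpa [cl, Finset.image_insert] using hpb' h hh
  · simpa [cl, Finset.image_insert] using hpb h hh
  · exact hF' i u
  · exact hF' i v
  · exact hF' j u
  · exact hF' j v
  · simpa [cl, Finset.image_insert] using hpa i (hpA' (by simp))
  · simpa [cl, Finset.image_insert] using hpa j (hpA' (by simp))
  · simpa [cl, Finset.image_insert] using hpc' u (hpA (by simp))
  · simpa [cl, Finset.image_insert] using hpc' v (hpA (by simp))

lemma TT_card3 {ι : Type} [Fintype ι] [DecidableEq ι] (S : Sys) (F : Finset (Finset ι))
    (hF : 0 < TT S F) : ∀ e ∈ F, e.card = 3 := by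
  obtain ⟨k, x, h⟩ := TT_pos_exists S F hF
  rw [subset_pat] at h
  exact fun e he => (h e he).1

lemma marks (S : Sys) (η : ℝ) (hη : 0 < η) (hη1 : η ≤ 1) (hd : S.d = 1/3 + η)
    (F : Finset (Finset (Fin r))) (hF : 0 < TT S F) :
    ∃ Γ : Fin r → Fin r → Fin r → Prop, (∀ c a b, Γ c a b → Γ c b a) ∧
      (∀ c a b e : Fin r, a ≠ b → a ≠ e → b ≠ e → a ≠ c → b ≠ c → e ≠ c → Γ c a b ∨ Γ c a e ∨ Γ c b e) ∧
      (∀ a b c, ({a, b, c} : Finset (Fin r)) ∈ F → Γ c a b → Γ a b c → False) := by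
  obtain ⟨κ, hκ, hκ1, N, hN⟩ := main_step S η hη hη1 hd r r
  have h3 := TT_card3 S F hF
  obtain ⟨D', A', hDD, hD', _, hA', _, hmk⟩ := hN (Fin (N+1)) univ (by simp) (bl (Fin (N+1)) F) (fun _ => univ)
    (TT_blow S _ F hF) (fun _ => Finset.univ_nonempty) (by simp) (by
      intro c _ p hp e he hsub
      simp only [bl, Finset.mem_filter, Finset.mem_univ, true_and] at he
      have hinj : Set.InjOn Prod.fst (e : Set (Fin r × Fin (N+1))) := by
        apply Finset.injOn_of_card_image_eq
        rw [h3 _ he.2, he.1]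
      obtain ⟨u, v, huv, rfl⟩ := Finset.card_eq_two.1 hp
      have h1 : (c, u) ∈ e := hsub (by simp [mem_cl])
      have h2 : (c, v) ∈ e := hsub (by simp [mem_cl])
      have := hinj h1 h2 rfl
      simp at this
      exact huv this)
  refine ⟨Mk D' A', ?_, fun c => hmk c (mem_univ c), ?_⟩
  · rintro c a b ⟨p, h1, h2, h3, h4⟩
    exact ⟨p, h1, h2, h4, h3⟩
  · intro a b c hF1 g1 g2
    have hc := h3 _ hF1
    have hab : a ≠ b := by
      rintro rfl
      have : ({a, a, c} : Finset (Fin r)).card ≤ 2 := by simpa using Finset.card_le_two (a := a) (b := c)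
      omega
    have hac : a ≠ c := by
      rintro rfl
      have : ({a, b, a} : Finset (Fin r)).card ≤ 2 := by
        rw [Finset.insert_comm]; simpa using Finset.card_le_two (a := b) (b := a)
      omega
    have hbc : b ≠ c := by
      rintro rfl
      have : ({a, b, b} : Finset (Fin r)).card ≤ 2 := by simpa using Finset.card_le_two (a := a) (b := b)
      omega
    exact no_two_marks S F D' A' hD' hDD hA' a b c hab hac hbc hF1 g1 g2

end marks

section counting

lemma sum_fin_cons {α : Type} [Fintype α] {n : ℕ} (G : (Fin (n+1) → α) → ℝ) :
    ∑ w, G w = ∑ a, ∑ w' : Fin n → α, G (Matrix.vecCons a w') := by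
  rw [← Equiv.sum_comp (Fin.consEquiv (fun _ : Fin (n+1) => α)), Fintype.sum_prod_type]; rfl

lemma sum_fin3 {α : Type} [Fintype α] (G : (Fin 3 → α) → ℝ) :
    ∑ w, G w = ∑ c, ∑ a, ∑ b, G ![c, a, b] := by
  simp only [sum_fin_cons, Fintype.sum_unique]
  rfl

lemma sum_fin6 {α : Type} [Fintype α] (G : (Fin 6 → α) → ℝ) :
    ∑ w, G w = ∑ c, ∑ a, ∑ b, ∑ x, ∑ y, ∑ z, G ![c, a, b, x, y, z] := by
  simp only [sum_fin_cons, Fintype.sum_unique]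
  rfl

lemma sum_fin9 {α : Type} [Fintype α] (G : (Fin 9 → α) → ℝ) :
    ∑ w, G w = ∑ c, ∑ a, ∑ b, ∑ x, ∑ y, ∑ z, ∑ x', ∑ y', ∑ z', G ![c, a, b, x, y, z, x', y', z'] := by
  simp only [sum_fin_cons, Fintype.sum_unique]
  rfl

/-- all triples through `0` -/
def St6 : Finset (Finset (Fin 6)) := univ.filter (fun e => e.card = 3 ∧ 0 ∈ e)

/-- push forward of a pattern -/
def push {ι κ : Type} [DecidableEq κ] (w : ι → κ) (D : Finset (Finset ι)) : Finset (Finset κ) :=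
  D.image (fun e => e.image w)

/-- two stars sharing two leaves -/
def St9 : Finset (Finset (Fin 9)) :=
  push ![0,1,2,3,4,5] St6 ∪ push ![0,1,2,6,7,8] St6

lemma St6_card : St6.card = 10 := by decide
lemma St9_card : St9.card = 19 := by decide

lemma push_push {ι κ μ : Type} [DecidableEq κ] [DecidableEq μ] (w : ι → κ) (v : κ → μ)
    (D : Finset (Finset ι)) : push v (push w D) = push (v ∘ w) D := by
  unfold push
  rw [Finset.image_image]
  congr 1
  ext1 e
  simp [Finset.image_image]

lemma push_union {ι κ : Type} [DecidableEq ι] [DecidableEq κ] (w : ι → κ) (D D' : Finset (Finset ι)) :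
    push w (D ∪ D') = push w D ∪ push w D' := Finset.image_union _ _

lemma push_card {ι κ : Type} [DecidableEq κ] (w : ι → κ) (hw : Function.Injective w)
    (D : Finset (Finset ι)) : (push w D).card = D.card := by
  unfold push
  exact Finset.card_image_of_injective _ (Finset.image_injective hw)

lemma TT_push {m r : ℕ} (S : Sys) (w : Fin m → Fin r) (hw : Function.Injective w) (c : Fin m)
    (D : Finset (Finset (Fin m))) (h3 : ∀ e ∈ D, e.card = 3) (hc : ∀ e ∈ D, c ∈ e) :
    TT S (push w D) = S.d ^ D.card := by
  rw [TT_star S (w c), push_card w hw]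
  · intro e he
    simp only [push, Finset.mem_image] at he
    obtain ⟨e', he', rfl⟩ := he
    rw [Finset.card_image_of_injective _ hw, h3 e' he']
  · intro e he
    simp only [push, Finset.mem_image] at he
    obtain ⟨e', he', rfl⟩ := he
    exact Finset.mem_image_of_mem w (hc e' he')

lemma St9_prop : ∀ e ∈ St9, e.card = 3 ∧ 0 ∈ e := by
  intro e he
  simp only [St9, push, St6, Finset.mem_union, Finset.mem_image, Finset.mem_filter, Finset.mem_univ,
    true_and] at he
  rcases he with ⟨e', ⟨h3, h0⟩, rfl⟩ | ⟨e', ⟨h3, h0⟩, rfl⟩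
  · refine ⟨?_, ?_⟩
    · rw [Finset.card_image_of_injective _ (by decide), h3]
    · exact Finset.mem_image.2 ⟨0, h0, by decide⟩
  · refine ⟨?_, ?_⟩
    · rw [Finset.card_image_of_injective _ (by decide), h3]
    · exact Finset.mem_image.2 ⟨0, h0, by decide⟩

lemma inj_count (m r : ℕ) (hr : m ≤ r) (hr0 : 0 < r) :
    (1 - (m : ℝ) * m / r) * (r : ℝ) ^ m ≤
      ((univ.filter (fun w : Fin m → Fin r => Function.Injective w)).card : ℝ) := by
  classical
  have h1 : (univ.filter (fun w : Fin m → Fin r => Function.Injective w)).card = r.descFactorial m := by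
    have := Fintype.card_embedding_eq (α := Fin m) (β := Fin r)
    rw [Fintype.card_fin, Fintype.card_fin] at this
    rw [← this, ← Fintype.card_subtype]
    exact Fintype.card_congr (Equiv.subtypeInjectiveEquivEmbedding _ _)
  rw [h1]
  have h2 : ((r + 1 - m) ^ m : ℕ) ≤ r.descFactorial m := Nat.pow_sub_le_descFactorial r m
  have h3 : ((r : ℝ) - m) ^ m ≤ (r.descFactorial m : ℝ) := by
    refine le_trans ?_ (Nat.cast_le.2 h2)
    push_cast [Nat.cast_sub (show m ≤ r + 1 by omega)]
    have : (m : ℝ) ≤ r := by exact_mod_cast hr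
    gcongr
    linarith
  refine le_trans ?_ h3
  have hrp : (0 : ℝ) < r := by exact_mod_cast hr0
  have hmr : (m : ℝ) / r ≤ 1 := by rw [div_le_one hrp]; exact_mod_cast hr
  have h4 := one_add_mul_le_pow (a := -((m : ℝ) / r)) (by linarith) m
  have h5 : ((r : ℝ) - m) ^ m = (1 + -((m : ℝ) / r)) ^ m * (r : ℝ) ^ m := by
    rw [← mul_pow]; congr 1; field_simp; ring
  rw [h5]
  gcongr
  refine le_trans (le_of_eq ?_) h4
  ring

end counting

section ineq
variable {r : ℕ}

/-- star indicator -/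
def KK (F : Finset (Finset (Fin r))) (w : Fin 6 → Fin r) : ℝ := ind (push w St6) F

/-- codegree-type count -/
def ZZ (F : Finset (Finset (Fin r))) (c a b : Fin r) : ℝ :=
  ∑ x, ∑ y, ∑ z, KK F ![c, a, b, x, y, z]

/-- edge indicator -/
def ff (F : Finset (Finset (Fin r))) (c a b : Fin r) : ℝ := ind {{c, a, b}} F

lemma KK_nonneg (F : Finset (Finset (Fin r))) (w : Fin 6 → Fin r) : 0 ≤ KK F w := ind_nonneg _ _

lemma push_sub_iff (F : Finset (Finset (Fin r))) (w : Fin 6 → Fin r) :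
    push w St6 ⊆ F ↔ ∀ i j : Fin 6, i ≠ 0 → j ≠ 0 → i ≠ j → ({w 0, w i, w j} : Finset (Fin r)) ∈ F := by
  unfold push
  rw [Finset.image_subset_iff]
  constructor
  · intro h i j hi hj hij
    have := h {0, i, j} (by
      simp only [St6, Finset.mem_filter, Finset.mem_univ, true_and]
      exact ⟨Finset.card_eq_three.2 ⟨_, _, _, hi.symm, hj.symm, hij, rfl⟩, by simp⟩)
    simpa [Finset.image_insert] using this
  · intro h e he
    simp only [St6, Finset.mem_filter, Finset.mem_univ, true_and] at he
    have h1 : (e.erase 0).card = 2 := by rw [Finset.card_erase_of_mem he.2, he.1]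
    obtain ⟨u, v, huv, hEq⟩ := Finset.card_eq_two.1 h1
    have hu : u ∈ e.erase 0 := by rw [hEq]; simp
    have hv : v ∈ e.erase 0 := by rw [hEq]; simp
    rw [← Finset.insert_erase he.2, hEq]
    simpa [Finset.image_insert] using
      h u v (Finset.ne_of_mem_erase hu) (Finset.ne_of_mem_erase hv) huv

lemma KK_perm (F : Finset (Finset (Fin r))) (w : Fin 6 → Fin r) (π : Equiv.Perm (Fin 6)) (hπ : π 0 = 0) :
    KK F (w ∘ π) = KK F w := by
  unfold KK ind
  have : push (w ∘ π) St6 ⊆ F ↔ push w St6 ⊆ F := by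
    rw [push_sub_iff, push_sub_iff]
    constructor
    · intro h i j hi hj hij
      have := h (π.symm i) (π.symm j) (by rw [Ne, Equiv.symm_apply_eq, hπ]; exact hi)
        (by rw [Ne, Equiv.symm_apply_eq, hπ]; exact hj) (by simpa using hij)
      simpa [hπ] using this
    · intro h i j hi hj hij
      have := h (π i) (π j) (by rw [← hπ]; simpa using hi) (by rw [← hπ]; simpa using hj) (by simpa using hij)
      simpa [hπ] using this
  simp only [this]

lemma perm_ex : ∀ i j : Fin 6, i ≠ 0 → j ≠ 0 → i ≠ j →
    ∃ π : Equiv.Perm (Fin 6), π 0 = 0 ∧ π 1 = i ∧ π 2 = j := by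
  intro i j hi hj hij
  refine ⟨(Equiv.swap 1 i) * (Equiv.swap 2 (Equiv.swap 1 i j)), ?_⟩
  revert i j
  decide

lemma sum_perm (F : Finset (Finset (Fin r))) (γ : Fin r → Fin r → Fin r → ℝ) (i j : Fin 6)
    (hi : i ≠ 0) (hj : j ≠ 0) (hij : i ≠ j) :
    ∑ w : Fin 6 → Fin r, KK F w * γ (w 0) (w i) (w j) = ∑ w : Fin 6 → Fin r, KK F w * γ (w 0) (w 1) (w 2) := by
  obtain ⟨π, h0, h1, h2⟩ := perm_ex i j hi hj hij
  rw [← Equiv.sum_comp (Equiv.arrowCongr π (Equiv.refl (Fin r))) (fun w => KK F w * γ (w 0) (w i) (w j))]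
  refine Finset.sum_congr rfl (fun w _ => ?_)
  have e : (Equiv.arrowCongr π (Equiv.refl (Fin r))) w = w ∘ π.symm := by
    ext; simp [Equiv.arrowCongr]
  rw [e, KK_perm F w π.symm (by rw [Equiv.symm_apply_eq, h0])]
  have : π.symm 0 = 0 := by rw [Equiv.symm_apply_eq, h0]
  have : π.symm i = 1 := by rw [Equiv.symm_apply_eq, h1]
  have : π.symm j = 2 := by rw [Equiv.symm_apply_eq, h2]
  simp [*]

lemma five_graph (G : Fin 5 → Fin 5 → ℕ) (hs : ∀ i j, G i j = G j i)
    (h : ∀ i j k : Fin 5, i ≠ j → i ≠ k → j ≠ k → 1 ≤ G i j + G i k + G j k) :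
    8 ≤ ∑ i, ∑ j, if i ≠ j then G i j else 0 := by
  simp only [Fin.sum_univ_five]
  simp (decide := true) only [if_true, if_false]
  rw [hs 1 0, hs 2 0, hs 3 0, hs 4 0, hs 2 1, hs 3 1, hs 4 1, hs 3 2, hs 4 2, hs 4 3]
  have h1 := h 0 1 2 (by decide) (by decide) (by decide)
  have h2 := h 0 1 3 (by decide) (by decide) (by decide)
  have h3 := h 0 1 4 (by decide) (by decide) (by decide)
  have h4 := h 0 2 3 (by decide) (by decide) (by decide)
  have h5 := h 0 2 4 (by decide) (by decide) (by decide)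
  have h6 := h 0 3 4 (by decide) (by decide) (by decide)
  have h7 := h 1 2 3 (by decide) (by decide) (by decide)
  have h8 := h 1 2 4 (by decide) (by decide) (by decide)
  have h9 := h 1 3 4 (by decide) (by decide) (by decide)
  have h10 := h 2 3 4 (by decide) (by decide) (by decide)
  have : 10 ≤ 3 * (G 0 1 + G 0 2 + G 0 3 + G 0 4 + G 1 2 + G 1 3 + G 1 4 + G 2 3 + G 2 4 + G 3 4) := by
    linarith
  omega

lemma ineqA (F : Finset (Finset (Fin r))) (h3 : ∀ e ∈ F, e.card = 3) (Γ : Fin r → Fin r → Fin r → Prop)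
    [∀ c a b, Decidable (Γ c a b)]
    (hsym : ∀ c a b, Γ c a b → Γ c b a)
    (hΓ : ∀ c a b e : Fin r, a ≠ b → a ≠ e → b ≠ e → a ≠ c → b ≠ c → e ≠ c → Γ c a b ∨ Γ c a e ∨ Γ c b e) :
    8 * ∑ w : Fin 6 → Fin r, KK F w ≤
      20 * ∑ w : Fin 6 → Fin r, KK F w * (if Γ (w 0) (w 1) (w 2) then 1 else 0) := by
  have e1 : ∑ i : Fin 5, ∑ j : Fin 5, (if i ≠ j then
      ∑ w : Fin 6 → Fin r, KK F w * (if Γ (w 0) (w i.succ) (w j.succ) then (1:ℝ) else 0) else 0) =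
      20 * ∑ w : Fin 6 → Fin r, KK F w * (if Γ (w 0) (w 1) (w 2) then 1 else 0) := by
    have : ∀ i j : Fin 5, (if i ≠ j then
      ∑ w : Fin 6 → Fin r, KK F w * (if Γ (w 0) (w i.succ) (w j.succ) then (1:ℝ) else 0) else 0) =
       (if i ≠ j then ∑ w : Fin 6 → Fin r, KK F w * (if Γ (w 0) (w 1) (w 2) then (1:ℝ) else 0) else 0) := by
      intro i j
      by_cases hij : i = j
      · simp [hij]
      · rw [if_pos hij, if_pos hij]
        exact sum_perm F (fun c a b => if Γ c a b then 1 else 0) i.succ j.succ (Fin.succ_ne_zero _)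
          (Fin.succ_ne_zero _) (by simpa using hij)
    simp_rw [this]
    generalize ∑ w : Fin 6 → Fin r, KK F w * (if Γ (w 0) (w 1) (w 2) then (1:ℝ) else 0) = t
    simp only [Fin.sum_univ_five]
    simp (decide := true) only [if_true, if_false]
    ring
  rw [← e1]
  have e2 : ∑ i : Fin 5, ∑ j : Fin 5, (if i ≠ j then
      ∑ w : Fin 6 → Fin r, KK F w * (if Γ (w 0) (w i.succ) (w j.succ) then (1:ℝ) else 0) else 0) =
      ∑ w : Fin 6 → Fin r, KK F w * ∑ i : Fin 5, ∑ j : Fin 5, (if i ≠ j then (if Γ (w 0) (w i.succ) (w j.succ) then (1:ℝ) else 0) else 0) := by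
    simp_rw [Finset.mul_sum]
    rw [Finset.sum_comm]
    simp_rw [Finset.sum_comm (s := (univ : Finset (Fin 6 → Fin r)))]
    rw [Finset.sum_comm]
    refine Finset.sum_congr rfl (fun i _ => Finset.sum_congr rfl (fun j _ => ?_))
    split_ifs <;> simp
  rw [e2, Finset.mul_sum]
  refine Finset.sum_le_sum (fun w _ => ?_)
  by_cases hK : push w St6 ⊆ F
  · have hK1 : KK F w = 1 := by unfold KK ind; rw [if_pos hK]
    rw [hK1, one_mul, mul_one]
    rw [push_sub_iff] at hK
    have hcd : ∀ i j : Fin 6, i ≠ 0 → j ≠ 0 → i ≠ j → w i ≠ w j ∧ w i ≠ w 0 := by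
      intro i j hi hj hij
      have hc := h3 _ (hK i j hi hj hij)
      constructor
      · intro h
        rw [h] at hc
        have : ({w 0, w j, w j} : Finset (Fin r)).card ≤ 2 := by simpa using Finset.card_le_two (a := w 0) (b := w j)
        omega
      · intro h
        rw [h] at hc
        have : ({w 0, w 0, w j} : Finset (Fin r)).card ≤ 2 := by simpa using Finset.card_le_two (a := w 0) (b := w j)
        omega
    have hcs : ∀ i j : Fin 5, i ≠ j → w i.succ ≠ w j.succ ∧ w i.succ ≠ w 0 := fun i j hij =>
      hcd _ _ (Fin.succ_ne_zero _) (Fin.succ_ne_zero _) (by simpa using hij)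
    have := five_graph (fun i j => if Γ (w 0) (w i.succ) (w j.succ) then 1 else 0)
      (by
        intro i j
        have h1 := hsym (w 0) (w i.succ) (w j.succ)
        have h2 := hsym (w 0) (w j.succ) (w i.succ)
        simp only [show Γ (w 0) (w i.succ) (w j.succ) ↔ Γ (w 0) (w j.succ) (w i.succ) from ⟨h1, h2⟩])
      (by
        intro i j k hij hik hjk
        rcases hΓ (w 0) (w i.succ) (w j.succ) (w k.succ) (hcs i j hij).1 (hcs i k hik).1 (hcs j k hjk).1
          (hcs i j hij).2 (hcs j k hjk).2 (hcs k i hik.symm).2 with h | h | h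
        · simp only [h, if_true]; omega
        · simp only [h, if_true]; omega
        · simp only [h, if_true]; omega)
    have h8 : (8 : ℝ) ≤ ((∑ i : Fin 5, ∑ j : Fin 5, if i ≠ j then (if Γ (w 0) (w i.succ) (w j.succ) then 1 else 0) else 0 : ℕ) : ℝ) := by
      exact_mod_cast this
    push_cast at h8
    exact h8
  · have hK1 : KK F w = 0 := by unfold KK ind; rw [if_neg hK]
    rw [hK1]; simp

lemma sumK (F : Finset (Finset (Fin r))) : ∑ w : Fin 6 → Fin r, KK F w = ∑ c, ∑ a, ∑ b, ZZ F c a b := by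
  rw [sum_fin6]; rfl

lemma sumKΓ (F : Finset (Finset (Fin r))) (γ : Fin r → Fin r → Fin r → ℝ) :
    ∑ w : Fin 6 → Fin r, KK F w * γ (w 0) (w 1) (w 2) = ∑ c, ∑ a, ∑ b, γ c a b * ZZ F c a b := by
  rw [sum_fin6]
  unfold ZZ
  simp_rw [Finset.mul_sum]
  refine Finset.sum_congr rfl (fun c _ => Finset.sum_congr rfl (fun a _ => Finset.sum_congr rfl (fun b _ =>
    Finset.sum_congr rfl (fun x _ => Finset.sum_congr rfl (fun y _ => Finset.sum_congr rfl (fun z _ => ?_))))))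
  rw [mul_comm]; rfl

lemma sum_cyc (G : Fin r → Fin r → Fin r → ℝ) :
    ∑ c, ∑ a, ∑ b, G a b c = ∑ c, ∑ a, ∑ b, G c a b := by
  rw [Finset.sum_comm]
  refine Finset.sum_congr rfl (fun a _ => ?_)
  rw [Finset.sum_comm]

lemma sumf (F : Finset (Finset (Fin r))) (h3 : ∀ e ∈ F, e.card = 3) (Γ : Fin r → Fin r → Fin r → Prop)
    [∀ c a b, Decidable (Γ c a b)]
    (hex : ∀ a b c, ({a, b, c} : Finset (Fin r)) ∈ F → Γ c a b → Γ a b c → False) :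
    3 * ∑ c, ∑ a, ∑ b, (if Γ c a b then 1 else 0) * ff F c a b ≤ ∑ c, ∑ a, ∑ b, ff F c a b := by
  set G : Fin r → Fin r → Fin r → ℝ := fun c a b => (if Γ c a b then 1 else 0) * ff F c a b with hG
  have c1 : ∑ c, ∑ a, ∑ b, G a b c = ∑ c, ∑ a, ∑ b, G c a b := sum_cyc G
  have c2 : ∑ c, ∑ a, ∑ b, G b c a = ∑ c, ∑ a, ∑ b, G c a b :=
    (sum_cyc (fun c a b => G a b c)).trans c1
  have : 3 * ∑ c, ∑ a, ∑ b, G c a b = ∑ c, ∑ a, ∑ b, (G c a b + G a b c + G b c a) := by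
    simp_rw [Finset.sum_add_distrib]
    rw [c1, c2]; ring
  rw [this]
  refine Finset.sum_le_sum (fun c _ => Finset.sum_le_sum (fun a _ => Finset.sum_le_sum (fun b _ => ?_)))
  have p1 : ({a, b, c} : Finset (Fin r)) = {c, a, b} := by ext; simp; tauto
  have p2 : ({b, c, a} : Finset (Fin r)) = {c, a, b} := by ext; simp; tauto
  have f1 : ff F a b c = ff F c a b := by unfold ff; rw [p1]
  have f2 : ff F b c a = ff F c a b := by unfold ff; rw [p2]
  simp only [hG, f1, f2]
  by_cases hF : ({c, a, b} : Finset (Fin r)) ∈ F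
  · have hf : ff F c a b = 1 := by simp [ff, ind, hF]
    rw [hf]
    have x1 := hex a b c (by rw [p1]; exact hF)
    have x2 := hex b c a (by rw [p2]; exact hF)
    have x3 := hex c a b hF
    by_cases g1 : Γ c a b <;> by_cases g2 : Γ a b c <;> by_cases g3 : Γ b c a <;> simp [g1, g2, g3] <;> tauto
  · have hf : ff F c a b = 0 := by simp [ff, ind, hF]
    rw [hf]; simp

lemma ffZ (F : Finset (Finset (Fin r))) (c a b : Fin r) : ff F c a b * ZZ F c a b = ZZ F c a b := by
  by_cases hF : ({c, a, b} : Finset (Fin r)) ∈ F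
  · have hf : ff F c a b = 1 := by simp [ff, ind, hF]
    rw [hf, one_mul]
  · have : ZZ F c a b = 0 := by
      unfold ZZ
      refine Finset.sum_eq_zero (fun x _ => Finset.sum_eq_zero (fun y _ => Finset.sum_eq_zero (fun z _ => ?_)))
      unfold KK ind
      rw [if_neg]
      rw [push_sub_iff]
      intro h
      exact hF (h 1 2 (by decide) (by decide) (by decide))
    rw [this, mul_zero]

lemma ff_sq (F : Finset (Finset (Fin r))) (c a b : Fin r) : ff F c a b * ff F c a b = ff F c a b := by
  unfold ff ind; split_ifs <;> simp

lemma pattern_ineq (S : Sys) (η : ℝ) (hη : 0 < η) (hη1 : η ≤ 1) (hd : S.d = 1/3 + η)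
    (F : Finset (Finset (Fin r))) (hF : 0 < TT S F) (D0 s : ℝ) (hD0 : 0 ≤ D0) (hs : 0 < s) :
    8 * ∑ w : Fin 6 → Fin r, KK F w ≤ 20 * (D0 / 3 * (∑ c, ∑ a, ∑ b, ff F c a b) +
      ((∑ c, ∑ a, ∑ b, ZZ F c a b ^ 2) - 2 * D0 * (∑ w : Fin 6 → Fin r, KK F w) +
        D0 ^ 2 * (∑ c, ∑ a, ∑ b, ff F c a b)) / (2 * s) + (r : ℝ) ^ 3 * (s / 2)) := by
  classical
  obtain ⟨Γ, hsym, hΓ, hex⟩ := marks S η hη hη1 hd F hF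
  have h3 := TT_card3 S F hF
  refine (ineqA F h3 Γ hsym hΓ).trans ?_
  rw [sumKΓ F (fun c a b => if Γ c a b then 1 else 0), sumK]
  have h4 := sumf F h3 Γ hex
  gcongr
  have h5 : ∑ c, ∑ a, ∑ b, (if Γ c a b then 1 else 0) * ZZ F c a b ≤
      ∑ c, ∑ a, ∑ b, (D0 * ((if Γ c a b then 1 else 0) * ff F c a b) +
        ((ZZ F c a b ^ 2 - 2 * D0 * ZZ F c a b + D0 ^ 2 * ff F c a b) * (1 / (2 * s)) + s / 2)) := by
    refine Finset.sum_le_sum (fun c _ => Finset.sum_le_sum (fun a _ => Finset.sum_le_sum (fun b _ => ?_)))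
    have hz := ffZ F c a b
    have hf := ff_sq F c a b
    generalize ZZ F c a b = Z at *
    generalize ff F c a b = f at *
    have hsq : Z ^ 2 - 2 * D0 * Z + D0 ^ 2 * f = (Z - f * D0) ^ 2 := by
      have : (Z - f * D0) ^ 2 = Z ^ 2 - 2 * D0 * (f * Z) + D0 ^ 2 * (f * f) := by ring
      rw [this, hz, hf]
    rw [hsq]
    have hamgm : ∀ t : ℝ, t ≤ t ^ 2 * (1 / (2 * s)) + s / 2 := by
      intro t
      have : t ^ 2 * (1 / (2 * s)) + s / 2 - t = (t - s) ^ 2 / (2 * s) := by field_simp; ring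
      have h2 : 0 ≤ (t - s) ^ 2 / (2 * s) := by positivity
      linarith
    by_cases g : Γ c a b
    · simp only [g, if_true, one_mul]
      have := hamgm (Z - f * D0)
      linarith
    · simp only [g, if_false, zero_mul, mul_zero, zero_add]
      have e1 := mul_nonneg (sq_nonneg (Z - f * D0)) (show (0:ℝ) ≤ 1 / (2 * s) by positivity)
      linarith
  refine h5.trans ?_
  simp only [Finset.sum_add_distrib, Finset.sum_sub_distrib, ← Finset.mul_sum, ← Finset.sum_mul]
  simp only [Finset.sum_const, Finset.card_univ, Fintype.card_fin, nsmul_eq_mul]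
  clear h5
  generalize (∑ c, ∑ a, ∑ b, ff F c a b) = X1 at *
  generalize (∑ c, ∑ a, ∑ b, (if Γ c a b then 1 else 0) * ff F c a b) = X2 at *
  have h6 : D0 * X2 ≤ D0 / 3 * X1 := by nlinarith
  have h7 : (r : ℝ) * (r * (r * (s / 2))) = (r : ℝ) ^ 3 * (s / 2) := by ring
  rw [h7]
  rw [one_div, ← div_eq_mul_inv]
  linarith

end ineq

section final
variable {r : ℕ}

lemma low_K (S : Sys) (hd0 : 0 ≤ S.d) (hr : 6 ≤ r) :
    (1 - (36 : ℝ) / r) * (r : ℝ) ^ 6 * S.d ^ 10 ≤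
      Lf S (fun F : Finset (Finset (Fin r)) => ∑ w : Fin 6 → Fin r, KK F w) := by
  classical
  rw [Lf_sum]
  have h1 := inj_count 6 r hr (by omega)
  have h2 : ∑ w ∈ univ.filter (fun w : Fin 6 → Fin r => Function.Injective w), S.d ^ 10 ≤
      ∑ w : Fin 6 → Fin r, Lf S (fun F : Finset (Finset (Fin r)) => KK F w) := by
    refine le_trans (Finset.sum_le_sum (g := fun w => TT S (push w St6)) ?_)
      (Finset.sum_le_sum_of_subset_of_nonneg (Finset.filter_subset _ _) (fun w _ _ => TT_nonneg S (push w St6)))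
    intro w hw
    rw [TT_push S w (by simpa using hw) 0 St6 (fun e he => by simp [St6] at he; exact he.1)
      (fun e he => by simp [St6] at he; exact he.2), St6_card]
  refine le_trans ?_ h2
  rw [Finset.sum_const, nsmul_eq_mul]
  refine mul_le_mul_of_nonneg_right (le_trans (le_of_eq ?_) h1) (pow_nonneg hd0 _)
  norm_num

lemma up_f (S : Sys) (hd0 : 0 ≤ S.d) :
    Lf S (fun F : Finset (Finset (Fin r)) => ∑ c, ∑ a, ∑ b, ff F c a b) ≤ (r : ℝ) ^ 3 * S.d := by
  simp only [Lf_sum]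
  have h : ∀ c a b : Fin r, Lf S (fun F : Finset (Finset (Fin r)) => ff F c a b) ≤ S.d := by
    intro c a b
    change TT S {{c, a, b}} ≤ S.d
    rcases (TT_nonneg S {{c, a, b}}).eq_or_lt with h0 | h0
    · rw [← h0]; exact hd0
    · have h3 := TT_card3 S _ h0
      rw [TT_star S c _ h3 (by simp)]
      simp
  calc _ ≤ ∑ c : Fin r, ∑ a : Fin r, ∑ b : Fin r, S.d :=
        Finset.sum_le_sum (fun c _ => Finset.sum_le_sum (fun a _ => Finset.sum_le_sum (fun b _ => h c a b)))
    _ = _ := by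
      simp only [Finset.sum_const, Finset.card_univ, Fintype.card_fin, nsmul_eq_mul]; ring

lemma KK_mul (F : Finset (Finset (Fin r))) (c a b x y z x' y' z' : Fin r) :
    KK F ![c, a, b, x, y, z] * KK F ![c, a, b, x', y', z'] =
      ind (push ![c, a, b, x, y, z, x', y', z'] St9) F := by
  unfold KK St9
  rw [push_union, push_push, push_push, ind_union]
  congr 3
  · ext i; fin_cases i <;> rfl
  · ext i; fin_cases i <;> rfl

lemma ZZ_sq (F : Finset (Finset (Fin r))) :
    ∑ c, ∑ a, ∑ b, ZZ F c a b ^ 2 = ∑ w : Fin 9 → Fin r, ind (push w St9) F := by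
  rw [sum_fin9]
  refine Finset.sum_congr rfl (fun c _ => Finset.sum_congr rfl (fun a _ => Finset.sum_congr rfl (fun b _ => ?_)))
  rw [pow_two]
  unfold ZZ
  simp only [Finset.sum_mul]
  simp only [Finset.mul_sum]
  refine Finset.sum_congr rfl (fun x _ => Finset.sum_congr rfl (fun y _ => Finset.sum_congr rfl (fun z _ =>
    Finset.sum_congr rfl (fun x' _ => Finset.sum_congr rfl (fun y' _ => Finset.sum_congr rfl (fun z' _ => ?_))))))
  exact KK_mul F c a b x y z x' y' z'

lemma up_Z (S : Sys) (hd0 : 0 ≤ S.d) (hr : 9 ≤ r) :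
    Lf S (fun F : Finset (Finset (Fin r)) => ∑ c, ∑ a, ∑ b, ZZ F c a b ^ 2) ≤
      (r : ℝ) ^ 9 * (S.d ^ 19 + 81 / r) := by
  classical
  simp only [ZZ_sq]
  rw [Lf_sum]
  have h1 := inj_count 9 r hr (by omega)
  have h2 : ∀ w : Fin 9 → Fin r, Lf S (ind (push w St9)) ≤
      S.d ^ 19 + (1 - if Function.Injective w then 1 else 0) := by
    intro w
    by_cases hw : Function.Injective w
    · have := TT_push S w hw 0 St9 (fun e he => (St9_prop e he).1) (fun e he => (St9_prop e he).2)
      rw [St9_card] at this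
      unfold TT at this
      simp [hw, this]
    · have := TT_le_one S (push w St9)
      unfold TT at this
      have h5 := pow_nonneg hd0 19
      simp only [hw, if_false]; linarith
  refine (Finset.sum_le_sum (fun w _ => h2 w)).trans ?_
  rw [Finset.sum_add_distrib, Finset.sum_sub_distrib, Finset.sum_boole]
  simp only [Finset.sum_const, Finset.card_univ, Fintype.card_fun, Fintype.card_fin, nsmul_eq_mul]
  push_cast at h1 ⊢
  have e : (1 - (9:ℝ) * 9 / r) * (r:ℝ) ^ 9 = r ^ 9 - r ^ 9 * (81 / r) := by ring
  rw [e] at h1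
  linarith

lemma no_sys (S : Sys) (η : ℝ) (hη : 0 < η) (hd : S.d = 1 / 3 + η) : False := by
  have hd1 := S.d_le_one
  have hη1 : η ≤ 1 := by linarith
  have hdp : 0 < S.d := by linarith
  set d := S.d with hdd
  have he : 0 < d ^ 10 := by positivity
  have he1 : d ^ 10 ≤ 1 := pow_le_one₀ hdp.le hd1
  have he19 : d ^ 19 ≤ 1 := pow_le_one₀ hdp.le hd1
  obtain ⟨r0, hr0⟩ := exists_nat_gt (81 * 2000 / (d ^ 10) ^ 2)
  obtain ⟨r, hr9, hrr⟩ : ∃ r : ℕ, 9 ≤ r ∧ (81 : ℝ) * 2000 / (d ^ 10) ^ 2 < r :=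
    ⟨r0 + 9, by omega, by push_cast; linarith⟩
  have hR : (0 : ℝ) < r := by
    have : (0 : ℕ) < r := by omega
    exact_mod_cast this
  set R : ℝ := (r : ℝ) with hRR
  set ξ : ℝ := 81 / R with hξ
  have hξ0 : 0 < ξ := by positivity
  have hξ1 : ξ ≤ (d ^ 10) ^ 2 / 2000 := by
    rw [div_lt_iff₀ (by positivity)] at hrr
    rw [hξ, div_le_iff₀ hR]
    linarith
  have k0 := low_K (r := r) S hdp.le (by omega)
  have f0 := up_f (r := r) S hdp.le
  have z0 := up_Z (r := r) S hdp.le hr9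
  rw [← hRR, ← hdd] at k0 f0 z0
  rw [← hξ] at z0
  have k1 : (1 - ξ) * R ^ 6 * d ^ 10 ≤
      Lf S (fun F : Finset (Finset (Fin r)) => ∑ w : Fin 6 → Fin r, KK F w) := by
    refine le_trans ?_ k0
    have : 36 / R ≤ ξ := by rw [hξ]; gcongr; norm_num
    gcongr
  obtain ⟨D0, hD0⟩ : ∃ D0 : ℝ, D0 = R ^ 3 * d ^ 9 := ⟨_, rfl⟩
  obtain ⟨s, hs⟩ : ∃ s : ℝ, s = R ^ 3 * (d ^ 10 / 20) := ⟨_, rfl⟩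
  have hspos : 0 < s := by rw [hs]; positivity
  have hDpos : 0 ≤ D0 := by rw [hD0]; positivity
  have main := Lf_nonpos S (fun F : Finset (Finset (Fin r)) =>
      (8 + 20 * D0 / s) * (∑ w : Fin 6 → Fin r, KK F w) +
      ((-(20 * (D0 / 3 + D0 ^ 2 / (2 * s)))) * (∑ c, ∑ a, ∑ b, ff F c a b) +
      ((-(10 / s)) * (∑ c, ∑ a, ∑ b, ZZ F c a b ^ 2) + (-(10 * R ^ 3 * s))))) (by
    intro F hF
    have := pattern_ineq S η hη hη1 hd F hF D0 s hDpos hspos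
    generalize (∑ c, ∑ a, ∑ b, ff F c a b) = X1 at *
    generalize (∑ c, ∑ a, ∑ b, ZZ F c a b ^ 2) = X2 at *
    generalize (∑ w : Fin 6 → Fin r, KK F w) = X3 at *
    have e : 20 * (D0 / 3 * X1 + (X2 - 2 * D0 * X3 + D0 ^ 2 * X1) / (2 * s) + (r : ℝ) ^ 3 * (s / 2)) =
      8 * X3 - ((8 + 20 * D0 / s) * X3 +
      ((-(20 * (D0 / 3 + D0 ^ 2 / (2 * s)))) * X1 +
      ((-(10 / s)) * X2 + (-(10 * R ^ 3 * s))))) := by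
      rw [← hRR]; field_simp; ring
    linarith)
  rw [Lf_add, Lf_add, Lf_add, Lf_smul, Lf_smul, Lf_smul, Lf_const] at main
  generalize Lf S (fun F : Finset (Finset (Fin r)) => ∑ w : Fin 6 → Fin r, KK F w) = k at *
  generalize Lf S (fun F : Finset (Finset (Fin r)) => ∑ c, ∑ a, ∑ b, ff F c a b) = p at *
  generalize Lf S (fun F : Finset (Finset (Fin r)) => ∑ c, ∑ a, ∑ b, ZZ F c a b ^ 2) = z at *
  have m1 : (8 + 20 * D0 / s) * ((1 - ξ) * R ^ 6 * d ^ 10) ≤ (8 + 20 * D0 / s) * k := by gcongr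
  have m2 : (20 * (D0 / 3 + D0 ^ 2 / (2 * s))) * p ≤ (20 * (D0 / 3 + D0 ^ 2 / (2 * s))) * (R ^ 3 * d) := by
    gcongr
  have m3 : (10 / s) * z ≤ (10 / s) * (R ^ 9 * (d ^ 19 + ξ)) := by gcongr
  have q : (8 + 20 * D0 / s) * ((1 - ξ) * R ^ 6 * d ^ 10) ≤
      (20 * (D0 / 3 + D0 ^ 2 / (2 * s))) * (R ^ 3 * d) + (10 / s) * (R ^ 9 * (d ^ 19 + ξ)) + 10 * R ^ 3 * s := by
    linarith
  have hdp' : d ≠ 0 := hdp.ne'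
  have a1 : (8 + 20 * D0 / s) * ((1 - ξ) * R ^ 6 * d ^ 10) = R ^ 6 * ((8 * d ^ 10 + 400 * d ^ 9) * (1 - ξ)) := by
    rw [hD0, hs]; field_simp; ring
  have a2 : (20 * (D0 / 3 + D0 ^ 2 / (2 * s))) * (R ^ 3 * d) + (10 / s) * (R ^ 9 * (d ^ 19 + ξ)) + 10 * R ^ 3 * s
      = R ^ 6 * (20 / 3 * d ^ 10 + 400 * d ^ 9 + 200 * (ξ / d ^ 10) + d ^ 10 / 2) := by
    rw [hD0, hs]; field_simp; ring
  rw [a1, a2] at q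
  have q2 := le_of_mul_le_mul_left q (by positivity)
  have b1 : ξ / d ^ 10 ≤ d ^ 10 / 2000 := by
    rw [div_le_iff₀ he]; linarith [hξ1]
  have b2 : d ^ 9 ≤ 1 := pow_le_one₀ hdp.le hd1
  have b3 : (8 * d ^ 10 + 400 * d ^ 9) * ξ ≤ 408 * ξ := by
    refine mul_le_mul_of_nonneg_right ?_ hξ0.le; linarith
  have b4 : ξ ≤ d ^ 10 / 2000 := by
    refine hξ1.trans ?_
    rw [pow_two]
    have := mul_le_mul_of_nonneg_left he1 he.le
    linarith
  linarith

end final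

/-- Corollary (`cor:main`): for every `ε > 0` there are `δ > 0` and `n₀` such that every
`3`-uniform hypergraph on at least `n₀` vertices all of whose link graphs are
`(δ, 1/3 + ε)`-quasirandom contains a copy of `K₅⁽³⁾`. -/
theorem quasirandom_links_contain_K5 :
    ∀ ε : ℝ, 0 < ε → ∃ (δ : ℝ) (n₀ : ℕ), 0 < δ ∧
      ∀ (V : Type) [Fintype V] [DecidableEq V] (E : Finset (Finset V)),
        (∀ e ∈ E, e.card = 3) →
        n₀ ≤ Fintype.card V →
        (∀ x : V, ∀ X : Finset V,
          |(linkEdgesIn E x X : ℝ) - (1/3 + ε) * ((X.card : ℝ))^2 / 2| ≤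
            δ * ((Fintype.card V : ℝ))^2) →
        ContainsK5 E := by
  intro ε hε
  by_contra hcon
  push Not at hcon
  have h1 : ∀ k : ℕ, ∃ H : HG, (∀ x X, |(linkEdgesIn H.E x X : ℝ) - (1/3 + ε) * ((X.card : ℝ))^2 / 2| ≤
      (1 / ((k : ℝ) + 1)) * ((Fintype.card H.V : ℝ))^2) ∧ ¬ ContainsK5 H.E := by
    intro k
    obtain ⟨V, i1, i2, E, h3, hn, hq, hno⟩ := hcon (1 / ((k : ℝ) + 1)) (k + 1) (by positivity)
    exact ⟨⟨V, i1, i2, E, h3, by omega⟩, hq, hno⟩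
  choose H hq hno using h1
  exact no_sys ⟨H, 1/3 + ε, hq, hno⟩ ε hε rfl
end
end
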